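/- The algebra (KP, ⋆) is freely generated by the set {M_a : a an unsplitable parking function}; that is, the canonical algebra map from the free associative K-algebra on the set of unsplitable parking functions, sending the generator a to M_a, is an isomorphism onto (KP, ⋆). -/

import Mathlib

open scoped Classical

/-- Words on natural numbers (letters are intended to be positive integers). -/
abbrev W : Type := List ℕ

/-- `IsPF a` : the word `a` is a parking function, i.e. all its letters are
positive and its nondecreasing rearrangement `b₁ b₂ ⋯ bₙ` satisfies `bᵢ ≤ i`. -/
def IsPF (a : W) : Prop :=
  (∀ x ∈ a, 1 ≤ x) ∧
    ∀ i, i < a.length → (a.insertionSort (· ≤ ·)).getD i 0 ≤ i + 1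

/-- Split a word into the consecutive segments beginning at its
left-to-right minima (in the order in which they occur in the word). -/
def segs : W → List W
  | [] => []
  | x :: xs =>
      (x :: xs.takeWhile fun y => x ≤ y) :: segs (xs.dropWhile fun y => x ≤ y)
termination_by a => a.length
decreasing_by
  simpa using Nat.lt_succ_of_le (List.dropWhile_sublist _).length_le

/-- The LR-decomposition `F_a` of a word `a`: the sequence of segments beginning
at the left-to-right minima, listed in increasing order of their minimal letters
(i.e. in reverse order of occurrence in `a`). -/
def LR (a : W) : List W := (segs a).reverse

/-- The word `w_k ⋯ w_2 w_1` encoded by an LR-decomposition `(w_1, …, w_k)`. -/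
def wordOf (F : List W) : W := F.reverse.flatten

/-- A word is dominated if it is nonempty and its first letter is its minimal letter. -/
def Dominated (w : W) : Prop := w ≠ [] ∧ ∀ x ∈ w, w.headD 0 ≤ x

/-- The minimal letter of a word (`0` for the empty word). -/
def minW (w : W) : ℕ := (w.min?).getD 0

/-- Add `m` to every letter of a word. -/
def shiftW (m : ℕ) (w : W) : W := w.map (· + m)

/-- Add `m` to every letter of every word of a sequence of words. -/
def shiftF (m : ℕ) (F : List W) : List W := F.map (shiftW m)

/-- The word whose LR-decomposition is the finite set of words `G`:
sort `G` increasingly (for dominated words with distinct minimal letters the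
lexicographic order agrees with comparing the minimal letters) and concatenate
in decreasing order. -/
noncomputable def wordOfSet (G : Finset W) : W := (G.sort (· ≤ ·)).reverse.flatten

/-- Given vertex sets `X`, `Y` (of words) and a set `Θ` of edges, the resulting
set of words: concatenations `u ++ w` over edges `(u, w) ∈ Θ`, together with all
unmatched words of `X` and of `Y`. -/
noncomputable def glueSet (X Y : Finset W) (Θ : Finset (W × W)) : Finset W :=
  Θ.image (fun p => p.1 ++ p.2) ∪
    X.filter (fun u => ∀ p ∈ Θ, p.1 ≠ u) ∪
    Y.filter (fun w => ∀ p ∈ Θ, p.2 ≠ w)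

/-- `R(a,b)` : the set of matchings between `F_a` and `F_b + m` (`m` the length
of `a`), encoded as sets of edges in which no vertex occurs twice. -/
noncomputable def Rset (a b : W) : Finset (Finset (W × W)) :=
  ((LR a).toFinset ×ˢ (shiftF a.length (LR b)).toFinset).powerset.filter
    (fun Θ => ∀ p ∈ Θ, ∀ q ∈ Θ, (p.1 = q.1 ∨ p.2 = q.2) → p = q)

/-- `aΘb` : the parking function whose LR-decomposition consists of the
concatenations `u ⬝ (w + m)` over the edges `(u, w + m)` of `Θ` together with all
unmatched words of `F_a` and of `F_b + m`. -/
noncomputable def mTheta (a b : W) (Θ : Finset (W × W)) : W :=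
  wordOfSet (glueSet (LR a).toFinset (shiftF a.length (LR b)).toFinset Θ)

/-- `d(a) = min { i : #{ j : a_j ≤ i } < i }`. -/
def dVal (a : W) : ℕ :=
  Nat.find (p := fun i => (a.filter (fun x => x ≤ i)).length < i)
    ⟨a.length + 1, Nat.lt_succ_of_le (List.length_filter_le _ _)⟩

/-- One step of the parkization algorithm: decrement every letter greater
than `d(a)`.  (This is the identity when `a` is a parking function.) -/
def parkStep (a : W) : W := a.map fun x => if dVal a < x then x - 1 else x

/-- Auxiliary fueled version of the parkization algorithm. -/
def parkFuel : ℕ → W → W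
  | 0, a => a
  | k + 1, a => if dVal a = a.length + 1 then a else parkFuel k (parkStep a)

/-- The parkization `Park a` of a word `a`.  (For a word with positive letters
the algorithm needs at most `a.sum` steps, so the fuel below suffices.) -/
def Park (a : W) : W := parkFuel a.sum a

/-- The subword of `a` obtained by keeping exactly the words of `F_a`
belonging to `S`. -/
def subWord (a : W) (S : Finset W) : W := wordOf ((LR a).filter (· ∈ S))

/-- The free module with basis indexed by words; the Hopf algebra `PFSym` is
its submodule spanned by `{M_a : a ∈ P}`. -/
abbrev FW (K : Type) [Field K] : Type := W →₀ K

/-- The monomial basis element `M_a`. -/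
noncomputable def Mb (K : Type) [Field K] (a : W) : FW K := Finsupp.single a 1

/-- `M_a ⋆ M_b = Σ_{Θ ∈ R(a,b)} M_{aΘb}` on basis elements. -/
noncomputable def mulSingle (K : Type) [Field K] (a b : W) : FW K :=
  ∑ Θ ∈ Rset a b, Mb K (mTheta a b Θ)

/-- The product `⋆`, extended bilinearly. -/
noncomputable def starF (K : Type) [Field K] (x y : FW K) : FW K :=
  x.sum fun a ca => y.sum fun b cb => (ca * cb) • mulSingle K a b

/-- The free module with basis indexed by pairs of words; it realizes the
tensor square of `FW K` via `M_a ⊗ M_b ↦ single (a,b)`. -/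
abbrev FW2 (K : Type) [Field K] : Type := (W × W) →₀ K

/-- `Δ(M_a) = Σ M_{Park a'} ⊗ M_{Park a''}` over ordered pairs `(a', a'')` of
subwords of `a` with `F_{a'} ⊍ F_{a''} = F_a` (encoded by the subset
`S ⊆ F_a` of words kept in `a'`). -/
noncomputable def deltaSingle (K : Type) [Field K] (a : W) : FW2 K :=
  ∑ S ∈ ((LR a).toFinset).powerset,
    Finsupp.single
      (Park (subWord a S), Park (subWord a (((LR a).toFinset) \ S))) 1

/-- The coproduct `Δ`, extended linearly. -/
noncomputable def deltaF (K : Type) [Field K] (x : FW K) : FW2 K :=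
  x.sum fun a ca => ca • deltaSingle K a

/-- The componentwise product on the tensor square, on basis elements:
`(M_a ⊗ M_b) ⋆ (M_c ⊗ M_d) = (M_a ⋆ M_c) ⊗ (M_b ⋆ M_d)`. -/
noncomputable def star2Single (K : Type) [Field K] (p q : W × W) : FW2 K :=
  ∑ Θ ∈ Rset p.1 q.1, ∑ Θ' ∈ Rset p.2 q.2,
    Finsupp.single (mTheta p.1 q.1 Θ, mTheta p.2 q.2 Θ') 1

/-- The componentwise product on the tensor square, extended bilinearly. -/
noncomputable def star2F (K : Type) [Field K] (x y : FW2 K) : FW2 K :=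
  x.sum fun p cp => y.sum fun q cq => (cp * cq) • star2Single K p q

/-- The counit `ε` on basis elements. -/
noncomputable def epsW (K : Type) [Field K] (a : W) : K := if a = [] then 1 else 0

/-- `F_a ∘ F_b` : concatenate the `i`-th words of `F_a` and `F_b + m`
for `i ≤ min(r,s)` and keep the remaining unpaired words. -/
def splitLR (F G : List W) : List W :=
  List.zipWith (· ++ ·) F G ++ F.drop G.length ++ G.drop F.length

/-- The split product `a ∘ b`. -/
def splitProd (a b : W) : W := wordOf (splitLR (LR a) (shiftF a.length (LR b)))

/-- A nonempty parking function is unsplitable if it is not the split product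
of two nonempty parking functions. -/
def UnsplitablePF (a : W) : Prop :=
  IsPF a ∧ a ≠ [] ∧
    ¬ ∃ b c : W, IsPF b ∧ IsPF c ∧ b ≠ [] ∧ c ≠ [] ∧ a = splitProd b c

/-- The slash product `a | b = (b₁+m) ⋯ (bₙ+m) a₁ ⋯ a_m`. -/
def slashProd (a b : W) : W := shiftW a.length b ++ a

/-- A nonempty parking function is atomic if it is not the slash product
of two nonempty parking functions. -/
def AtomicPF (a : W) : Prop :=
  IsPF a ∧ a ≠ [] ∧
    ¬ ∃ b c : W, IsPF b ∧ IsPF c ∧ b ≠ [] ∧ c ≠ [] ∧ a = slashProd b c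

/-- `u ≺* v` : either `v` is a proper initial subword of `u`, or `u` is not a
proper initial subword of `v` and `u` precedes `v` lexicographically. -/
def precStar (u v : W) : Prop :=
  (v <+: u ∧ v ≠ u) ∨ (¬ (u <+: v ∧ u ≠ v) ∧ List.Lex (· < ·) u v)

/-- `a ≺*_lex b` : `F_a` strictly precedes `F_b` in the lexicographic order
on sequences of words induced by `≺*`. -/
def precStarLex (a b : W) : Prop := List.Lex precStar (LR a) (LR b)

/-- The covering relation of `≤_*` : `b` covers `a` if `F_b` is obtained from
`F_a = (w_1, …, w_r)` by replacing `w_i` by `w_i ⬝ w_j` and removing `w_j`,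
for some `i < j` such that every letter of `w_i` is at most every letter of `w_j`. -/
def CovStar (a b : W) : Prop :=
  ∃ i j, i < j ∧ j < (LR a).length ∧
    (∀ x ∈ (LR a).getD i [], ∀ y ∈ (LR a).getD j [], x ≤ y) ∧
    LR b = ((LR a).set i ((LR a).getD i [] ++ (LR a).getD j [])).eraseIdx j

/-- The partial order `≤_*` on parking functions, generated by the covering
relations. -/
def leStar (a b : W) : Prop := Relation.ReflTransGen CovStar a b

/-- The finite set of all parking functions of length `n`. -/
noncomputable def pfFinset (n : ℕ) : Finset W :=
  ((Finset.univ : Finset (Fin n → Fin n)).image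
      (fun f => List.ofFn fun i => (f i).val + 1)).filter IsPF

/-- The basis element `Q_a = Σ_{a ≤_* b} M_b`. -/
noncomputable def Qb (K : Type) [Field K] (a : W) : FW K :=
  ∑ b ∈ (pfFinset a.length).filter (fun b => leStar a b), Mb K b

/-- `Q_x ⊗ Q_y` as an element of the tensor square. -/
noncomputable def QT (K : Type) [Field K] (x y : W) : FW2 K :=
  ∑ b ∈ (pfFinset x.length).filter (fun b => leStar x b),
    ∑ c ∈ (pfFinset y.length).filter (fun c => leStar y c),
      Finsupp.single (b, c) 1

/-- `a` is a nonincreasing word. -/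
def NonInc (a : W) : Prop := a.Chain' (fun x y => y ≤ x)

/-- Every word of the LR-decomposition of `a` is nondecreasing. -/
def Nprop (a : W) : Prop := ∀ w ∈ LR a, w.Chain' (· ≤ ·)

/-- The words of the LR-decomposition of `a` have pairwise disjoint sets of letters. -/
def Dprop (a : W) : Prop := (LR a).Pairwise (fun u v => ∀ x ∈ u, x ∉ v)

/-- `a` is a permutation of `{1, …, n}` viewed as a word. -/
def Sprop (a : W) : Prop := a.Perm (List.range' 1 a.length)


/-- The `⋆`-product `M_{x₁} ⋆ M_{x₂} ⋆ ⋯ ⋆ M_{xₖ}` of monomial basis elements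
along a list; this realizes the canonical algebra map from the free associative
algebra (whose basis consists of words in the generators). -/
noncomputable def starList (K : Type) [Field K] (L : List W) : FW K :=
  L.foldr (fun x acc => starF K (Mb K x) acc) (Mb K [])

/-- A good sequence of words: dominated, with strictly increasing heads. -/
def GoodL (F : List W) : Prop :=
  (∀ w ∈ F, Dominated w) ∧ F.Pairwise (fun u v => u.headD 0 < v.headD 0)

theorem segs_flatten (a : W) : (segs a).flatten = a := by
  induction a using segs.induct with
  | case1 => simp [segs]
  | case2 x xs ih => 
    rw [segs, List.flatten_cons, ih, List.cons_append, List.takeWhile_append_dropWhile]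

theorem segs_mem_subset (a : W) (w : W) (hw : w ∈ segs a) : ∀ x ∈ w, x ∈ a := by
  intro x hx
  rw [← segs_flatten a]
  exact List.mem_flatten.2 ⟨w, hw, hx⟩

theorem segs_dominated (a : W) : ∀ w ∈ segs a, Dominated w := by
  induction a using segs.induct with
  | case1 => simp [segs]
  | case2 x xs ih => 
    rw [segs]
    intro w hw
    rcases List.mem_cons.1 hw with rfl | hw
    · refine ⟨by simp, ?_⟩
      intro y hy
      rcases List.mem_cons.1 hy with rfl | hy
      · simp
      · simpa using List.mem_takeWhile_imp hy
    · exact ih w hw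

theorem headD_mem {w : W} (h : w ≠ []) : w.headD 0 ∈ w := by
  cases w with
  | nil => exact absurd rfl h
  | cons x xs => simp

/-- heads of segs decrease and are at most the head of the word -/
theorem segs_pairwise (a : W) :
    (segs a).Pairwise (fun u v => v.headD 0 < u.headD 0) ∧ 
    ∀ w ∈ segs a, w.headD 0 ≤ a.headD 0 := by
  induction a using segs.induct with
  | case1 => simp [segs]
  | case2 x xs ih => 
    rw [segs]
    have key : ∀ w ∈ segs (xs.dropWhile fun y => x ≤ y), w.headD 0 < x := by
      intro w hw
      have h1 := ih.2 w hw
      have hne : (xs.dropWhile fun y => decide (x ≤ y)) ≠ [] := by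
        intro h
        rw [h] at hw
        simp [segs] at hw
      have h2 := List.head_dropWhile_not (fun y => decide (x ≤ y)) hne
      have h3 : (xs.dropWhile fun y => decide (x ≤ y)).headD 0 = 
        (xs.dropWhile fun y => decide (x ≤ y)).head hne := by
        revert hne
        cases (xs.dropWhile fun y => decide (x ≤ y)) with
        | nil => intro h; exact absurd rfl h
        | cons y ys => intro h; simp
      rw [h3] at h1
      simp at h2
      omega
    refine ⟨List.pairwise_cons.2 ⟨?_, ih.1⟩, ?_⟩
    · intro w hw
      simpa using key w hw
    · intro w hw
      rcases List.mem_cons.1 hw with rfl | hw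
      · simp
      · exact (key w hw).le

theorem LR_good (a : W) : GoodL (LR a) := by
  refine ⟨fun w hw => segs_dominated a w (by simpa [LR] using hw), ?_⟩
  rw [LR, List.pairwise_reverse]
  exact (segs_pairwise a).1

theorem wordOf_LR (a : W) : wordOf (LR a) = a := by
  simp [wordOf, LR, segs_flatten]

theorem takeWhile_append_of_all {p : ℕ → Bool} {l r : List ℕ} (h : ∀ x ∈ l, p x = true) 
    (hr : ∀ y ∈ r.head?, p y = false) : 
    (l ++ r).takeWhile p = l ∧ (l ++ r).dropWhile p = r := by
  induction l with
  | nil => 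
    cases r with
    | nil => simp
    | cons y ys => 
      have := hr y (by simp)
      simp [this]
  | cons x xs ih =>
    have hx := h x (by simp)
    have := ih (fun y hy => h y (by simp [hy]))
    simp [hx, this]

theorem segs_of_good (L : List W) (h1 : ∀ w ∈ L, Dominated w) 
    (h2 : L.Pairwise (fun u v => v.headD 0 < u.headD 0)) : segs L.flatten = L := by
  induction L with
  | nil => simp [segs]
  | cons w L ih =>
    have hw := h1 w (by simp)
    obtain ⟨h2a, h2b⟩ := List.pairwise_cons.1 h2
    have ih := ih (fun v hv => h1 v (by simp [hv])) h2b
    cases w with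
    | nil => exact absurd rfl hw.1
    | cons x xs =>
      have hA : ∀ y ∈ xs, decide (x ≤ y) = true := by
        intro y hy
        have := hw.2 y (by simp [hy])
        simpa using this
      have hB : ∀ y ∈ L.flatten.head?, decide (x ≤ y) = false := by
        intro y hy
        cases L with
        | nil => simp at hy
        | cons v L =>
          have hv := h1 v (by simp)
          have h3 := h2a v (by simp)
          cases v with
          | nil => exact absurd rfl hv.1
          | cons z zs => 
            simp at hy h3 ⊢
            omega
      obtain ⟨t1, t2⟩ := takeWhile_append_of_all hA hB
      rw [List.flatten_cons, List.cons_append, segs, t1, t2, ih]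

theorem LR_wordOf {F : List W} (h : GoodL F) : LR (wordOf F) = F := by
  rw [LR, wordOf, segs_of_good]
  · simp
  · simpa using h.1
  · rw [List.pairwise_reverse]; exact h.2

theorem LR_inj {a b : W} (h : LR a = LR b) : a = b := by
  rw [← wordOf_LR a, h, wordOf_LR]

theorem GoodL.nodup {F : List W} (h : GoodL F) : F.Nodup :=
  h.2.imp (fun h e => by rw [e] at h; exact lt_irrefl _ h)

theorem GoodL.perm_eq {F G : List W} (hF : GoodL F) (hG : GoodL G) (h : F.Perm G) : F = G := by
  refine List.Perm.eq_of_pairwise ?_ hF.2 hG.2 h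
  intro a b _ _ h1 h2
  exact absurd h1 (by omega)

theorem GoodL.inj {F : List W} (h : GoodL F) {u v : W} (hu : u ∈ F) (hv : v ∈ F) 
    (e : u.headD 0 = v.headD 0) : u = v := by
  have h2 : (F.map (fun w => w.headD 0)).Nodup := by
    rw [List.Nodup, List.pairwise_map]
    exact h.2.imp (fun h => h.ne)
  exact List.inj_on_of_nodup_map h2 hu hv e

theorem segs_nil : LR [] = [] := by simp [LR, segs]

theorem LR_ne_nil {a : W} (h : a ≠ []) : LR a ≠ [] := by
  intro e
  apply h
  rw [← wordOf_LR a, e]; rfl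

/-- validity for multisets of words -/
def ValidM (G : Multiset W) : Prop :=
  (∀ w ∈ G, Dominated w) ∧ (G.map (fun w => w.headD 0)).Nodup

theorem GoodL.valid {F : List W} (h : GoodL F) : ValidM (F : Multiset W) := by
  refine ⟨fun w hw => h.1 w (by simpa using hw), ?_⟩
  rw [Multiset.map_coe, Multiset.coe_nodup, List.Nodup, List.pairwise_map]
  exact h.2.imp (fun h => h.ne)

theorem ValidM.nodup {G : Multiset W} (h : ValidM G) : G.Nodup := Multiset.Nodup.of_map _ h.2

theorem headD_le_of_le {u v : W} (hv : u ≠ []) (h : u ≤ v) : u.headD 0 ≤ v.headD 0 := by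
  cases u with
  | nil => exact absurd rfl hv
  | cons x xs =>
    cases v with
    | nil => exact absurd h (by simp)
    | cons y ys => 
      by_contra hlt
      have h3 : (y :: ys) < (x :: xs) := List.Lex.rel (by simpa using hlt)
      exact absurd h (not_le_of_gt h3)

theorem LR_wordOfSet {G : Finset W} (h : ValidM G.val) : LR (wordOfSet G) = G.sort (· ≤ ·) := by
  apply LR_wordOf
  refine ⟨fun w hw => h.1 w (by simpa using hw), ?_⟩
  have h1 := Finset.pairwise_sort G (· ≤ ·)
  have h2 : ((G.sort (· ≤ ·)).map (fun w => w.headD 0)).Nodup := by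
    rw [← Multiset.coe_nodup, ← Multiset.map_coe, Finset.sort_eq]
    exact h.2
  rw [List.Nodup, List.pairwise_map] at h2
  refine (h1.and h2).imp_of_mem ?_
  intro u v hu _ huv
  exact lt_of_le_of_ne (headD_le_of_le (h.1 u (by simpa using hu)).1 huv.1) huv.2

theorem LR_wordOfSet_coe {G : Finset W} (h : ValidM G.val) : 
    (LR (wordOfSet G) : Multiset W) = G.val := by
  rw [LR_wordOfSet h, Finset.sort_eq]

theorem exists_of_valid {G : Multiset W} (h : ValidM G) : ∃ a, (LR a : Multiset W) = G :=
  ⟨wordOfSet ⟨G, h.nodup⟩, LR_wordOfSet_coe (G := ⟨G, h.nodup⟩) h⟩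

theorem LR_coe_inj {a b : W} (h : (LR a : Multiset W) = LR b) : a = b :=
  LR_inj ((LR_good a).perm_eq (LR_good b) (Multiset.coe_eq_coe.1 h))

theorem wordOfSet_LR (a : W) : wordOfSet (LR a).toFinset = a := by
  have e : (LR a).toFinset.val = (LR a : Multiset W) := by
    rw [List.toFinset_val, (LR_good a).nodup.dedup]
  apply LR_coe_inj
  rw [LR_wordOfSet_coe, e]
  rw [e]; exact (LR_good a).valid

/-- letters at most `m` -/
def lo (m : ℕ) (w : W) : W := w.filter (fun x => decide (x ≤ m))

/-- letters greater than `m`, shifted down by `m` -/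
def hi (m : ℕ) (w : W) : W := (w.filter (fun x => decide (m < x))).map (fun x => x - m)

/-- small letters come first -/
def Cut (m : ℕ) (w : W) : Prop := w.Pairwise (fun x y => y ≤ m → x ≤ m)

theorem Cut.eq {m : ℕ} {w : W} (h : Cut m w) : lo m w ++ shiftW m (hi m w) = w := by
  have e : shiftW m (hi m w) = w.filter (fun x => decide (m < x)) := by
    rw [shiftW, hi, List.map_map]
    conv_rhs => rw [← List.map_id (w.filter (fun x => decide (m < x)))]
    apply List.map_congr_left
    intro x hx
    have := (List.mem_filter.1 hx).2
    simp at this ⊢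
    omega
  rw [e, lo]
  induction w with
  | nil => simp
  | cons x xs ih =>
    obtain ⟨h1, h2⟩ := List.pairwise_cons.1 h
    by_cases hx : x ≤ m
    · have h3 : ¬ m < x := by omega
      have ih := ih h2 (by 
        rw [shiftW, hi, List.map_map]
        conv_rhs => rw [← List.map_id (xs.filter (fun x => decide (m < x)))]
        apply List.map_congr_left
        intro x hx
        have := (List.mem_filter.1 hx).2
        simp at this ⊢
        omega)
      simp [hx, h3, ih]
    · have h3 : m < x := by omega
      have h4 : xs.filter (fun x => decide (x ≤ m)) = [] := by
        rw [List.filter_eq_nil_iff]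
        intro y hy
        have := h1 y hy
        simp; omega
      have h5 : xs.filter (fun x => decide (m < x)) = xs := by
        rw [List.filter_eq_self]
        intro y hy
        have := h1 y hy
        simp; omega
      simp [hx, h3, h4, h5]

theorem lo_append (m : ℕ) (u v : W) : lo m (u ++ v) = lo m u ++ lo m v := by simp [lo]
theorem hi_append (m : ℕ) (u v : W) : hi m (u ++ v) = hi m u ++ hi m v := by simp [hi]
theorem lo_nil (m : ℕ) : lo m [] = [] := rfl
theorem hi_nil (m : ℕ) : hi m [] = [] := rfl

theorem lo_of_le {m : ℕ} {u : W} (h : ∀ x ∈ u, x ≤ m) : lo m u = u := by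
  rw [lo, List.filter_eq_self]; simpa using h

theorem hi_of_le {m : ℕ} {u : W} (h : ∀ x ∈ u, x ≤ m) : hi m u = [] := by
  rw [hi, List.map_eq_nil_iff, List.filter_eq_nil_iff]; simpa using h

theorem lo_shift {m : ℕ} {u : W} (h : ∀ x ∈ u, 1 ≤ x) : lo m (shiftW m u) = [] := by
  rw [lo, shiftW, List.filter_eq_nil_iff]
  intro x hx
  obtain ⟨y, hy, rfl⟩ := List.mem_map.1 hx
  have := h y hy
  simp; omega

theorem hi_shift {m : ℕ} {u : W} (h : ∀ x ∈ u, 1 ≤ x) : hi m (shiftW m u) = u := by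
  have e : (shiftW m u).filter (fun x => decide (m < x)) = shiftW m u := by
    rw [List.filter_eq_self]
    intro x hx
    obtain ⟨y, hy, rfl⟩ := List.mem_map.1 hx
    have := h y hy
    simp; omega
  rw [hi, e, shiftW, List.map_map]
  conv_rhs => rw [← List.map_id u]
  apply List.map_congr_left
  intro x hx
  simp

theorem mem_lo {m x : ℕ} {w : W} : x ∈ lo m w ↔ x ∈ w ∧ x ≤ m := by simp [lo]
theorem mem_hi {m x : ℕ} {w : W} (h : x ∈ hi m w) : x + m ∈ w ∧ 1 ≤ x := by
  rw [hi] at h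
  obtain ⟨y, hy, rfl⟩ := List.mem_map.1 h
  have := List.mem_filter.1 hy
  have h2 : m < y := by simpa using this.2
  refine ⟨?_, by omega⟩
  rw [Nat.sub_add_cancel h2.le]; exact this.1

theorem lo_lo (m n : ℕ) (w : W) : lo m (lo (m + n) w) = lo m w := by
  rw [lo, lo, lo, List.filter_filter]
  apply List.filter_congr
  intro x _
  simp; omega

theorem hi_hi (m n : ℕ) (w : W) : hi n (hi m w) = hi (m + n) w := by
  rw [hi, hi, hi, List.filter_map, List.map_map, List.filter_filter]
  congr 1
  · funext x; simp; omega
  · apply List.filter_congr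
    intro x _
    rw [Bool.eq_iff_iff]
    simp; omega

theorem lo_hi (m n : ℕ) (w : W) : lo n (hi m w) = hi m (lo (m + n) w) := by
  rw [hi, hi, lo, lo, List.filter_map, List.filter_filter, List.filter_filter]
  congr 1
  apply List.filter_congr
  intro x _
  rw [Bool.eq_iff_iff]
  simp; omega

theorem cut_three (m n : ℕ) (w : W) : 
    (Cut (m + n) w ∧ Cut m (lo (m + n) w)) ↔ (Cut m w ∧ Cut n (hi m w)) := by
  unfold Cut lo hi
  rw [List.pairwise_map, List.pairwise_filter, List.pairwise_filter, ← List.pairwise_and_iff, 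
    ← List.pairwise_and_iff]
  constructor
  · refine List.Pairwise.imp ?_
    intro x y h
    simp at h ⊢
    omega
  · refine List.Pairwise.imp ?_
    intro x y h
    simp at h ⊢
    omega

def LOs (m : ℕ) (G : Multiset W) : Multiset W := (G.map (lo m)).filter (fun w => w ≠ [])
def HIs (m : ℕ) (G : Multiset W) : Multiset W := (G.map (hi m)).filter (fun w => w ≠ [])

theorem filter_map_filter (f : W → W) (hf : f [] = []) (G : Multiset W) : 
    ((G.filter (fun w => w ≠ [])).map f).filter (fun w => w ≠ []) = 
    (G.map f).filter (fun w => w ≠ []) := by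
  rw [Multiset.filter_map, Multiset.filter_map, Multiset.filter_filter]
  congr 1
  apply Multiset.filter_congr
  intro x _
  constructor
  · exact fun h => h.1
  · intro h
    refine ⟨h, ?_⟩
    rintro rfl
    exact h hf

theorem LOs_LOs (m n : ℕ) (D : Multiset W) : LOs m (LOs (m + n) D) = LOs m D := by
  rw [LOs, LOs, LOs, filter_map_filter _ (lo_nil m), Multiset.map_map]
  congr 1
  apply Multiset.map_congr rfl
  intro x _
  exact lo_lo m n x

theorem HIs_HIs (m n : ℕ) (D : Multiset W) : HIs n (HIs m D) = HIs (m + n) D := by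
  rw [HIs, HIs, HIs, filter_map_filter _ (hi_nil n), Multiset.map_map]
  congr 1
  apply Multiset.map_congr rfl
  intro x _
  exact hi_hi m n x

theorem LOs_HIs (m n : ℕ) (D : Multiset W) : LOs n (HIs m D) = HIs m (LOs (m + n) D) := by
  rw [HIs, HIs, LOs, LOs, filter_map_filter _ (hi_nil m), filter_map_filter _ (lo_nil n), 
    Multiset.map_map, Multiset.map_map]
  congr 1
  apply Multiset.map_congr rfl
  intro x _
  exact lo_hi m n x

theorem mem_LOs {m : ℕ} {G : Multiset W} {w : W} : 
    w ∈ LOs m G ↔ (∃ v ∈ G, lo m v = w) ∧ w ≠ [] := by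
  simp [LOs]
theorem mem_HIs {m : ℕ} {G : Multiset W} {w : W} : 
    w ∈ HIs m G ↔ (∃ v ∈ G, hi m v = w) ∧ w ≠ [] := by
  simp [HIs]

theorem headD_append {u v : W} (h : u ≠ []) : (u ++ v).headD 0 = u.headD 0 := by
  cases u with
  | nil => exact absurd rfl h
  | cons x xs => simp

theorem headD_shift {m : ℕ} {u : W} (h : u ≠ []) : (shiftW m u).headD 0 = u.headD 0 + m := by
  cases u with
  | nil => exact absurd rfl h
  | cons x xs => simp [shiftW]

theorem Cut.head_lo {m : ℕ} {w : W} (h : Cut m w) (h2 : lo m w ≠ []) : 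
    w.headD 0 = (lo m w).headD 0 := by
  conv_lhs => rw [← h.eq]
  exact headD_append h2

theorem Cut.head_hi {m : ℕ} {w : W} (h : Cut m w) (h2 : lo m w = []) (h3 : w ≠ []) : 
    w.headD 0 = (hi m w).headD 0 + m ∧ hi m w ≠ [] := by
  have e := h.eq
  rw [h2, List.nil_append] at e
  have h4 : hi m w ≠ [] := by
    intro h5
    rw [h5] at e
    exact h3 e.symm
  refine ⟨?_, h4⟩
  conv_lhs => rw [← e]
  exact headD_shift h4

theorem valid_LOs {k : ℕ} {D : Multiset W} (hD : ValidM D) (hc : ∀ w ∈ D, Cut k w) : 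
    ValidM (LOs k D) := by
  constructor
  · intro w hw
    obtain ⟨⟨v, hv, rfl⟩, hne⟩ := mem_LOs.1 hw
    refine ⟨hne, fun x hx => ?_⟩
    rw [← (hc v hv).head_lo hne]
    exact (hD.1 v hv).2 x (mem_lo.1 hx).1
  · rw [LOs, Multiset.filter_map, Multiset.map_map]
    have : Multiset.map ((fun w => List.headD w 0) ∘ lo k) (D.filter ((fun w => w ≠ []) ∘ lo k)) = 
      Multiset.map (fun w => List.headD w 0) (D.filter ((fun w => w ≠ []) ∘ lo k)) := by
      apply Multiset.map_congr rfl
      intro x hx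
      have := Multiset.mem_filter.1 hx
      exact ((hc x this.1).head_lo this.2).symm
    rw [this]
    exact Multiset.nodup_of_le (Multiset.map_le_map (Multiset.filter_le _ _)) hD.2

theorem valid_of_parts {n : ℕ} {G : Multiset W} (hne : ∀ w ∈ G, w ≠ []) (hc : ∀ w ∈ G, Cut n w)
    (h1 : ValidM (LOs n G)) (h2 : ValidM (HIs n G)) : ValidM G := by
  constructor
  · intro w hw
    refine ⟨hne w hw, fun x hx => ?_⟩
    by_cases hl : lo n w = []
    · obtain ⟨e, hh⟩ := (hc w hw).head_hi hl (hne w hw)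
      have hd := h2.1 (hi n w) (mem_HIs.2 ⟨⟨w, hw, rfl⟩, hh⟩)
      rw [e]
      rw [← (hc w hw).eq, hl, List.nil_append] at hx
      obtain ⟨y, hy, rfl⟩ := List.mem_map.1 hx
      have := hd.2 y hy
      omega
    · have hd := h1.1 (lo n w) (mem_LOs.2 ⟨⟨w, hw, rfl⟩, hl⟩)
      rw [(hc w hw).head_lo hl]
      by_cases hxn : x ≤ n
      · exact hd.2 x (mem_lo.2 ⟨hx, hxn⟩)
      · have := (mem_lo.1 (headD_mem hl)).2
        omega
  · rw [← Multiset.filter_add_not (fun w => lo n w ≠ []) G, Multiset.map_add, Multiset.nodup_add]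
    refine ⟨?_, ?_, ?_⟩
    · have h3 := h1.2
      rw [LOs, Multiset.filter_map, Multiset.map_map] at h3
      convert h3 using 1
      apply Multiset.map_congr rfl
      intro x hx
      have := Multiset.mem_filter.1 hx
      exact (hc x this.1).head_lo this.2
    · have h3 := h2.2
      rw [HIs, Multiset.filter_map, Multiset.map_map] at h3
      have h4 : (G.filter (fun w => ¬ lo n w ≠ [])) ≤ G.filter ((fun w => w ≠ []) ∘ hi n) := by
        rw [Multiset.le_filter]
        refine ⟨Multiset.filter_le _ _, ?_⟩
        intro x hx
        have := Multiset.mem_filter.1 hx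
        exact ((hc x this.1).head_hi (not_not.1 this.2) (hne x this.1)).2
      have h5 := Multiset.nodup_of_le (Multiset.map_le_map h4) h3
      have h6 := Multiset.Nodup.map (f := fun x => x + n) (add_left_injective n) h5
      rw [Multiset.map_map] at h6
      convert h6 using 1
      apply Multiset.map_congr rfl
      intro x hx
      have := Multiset.mem_filter.1 hx
      exact ((hc x this.1).head_hi (not_not.1 this.2) (hne x this.1)).1
    · rw [Multiset.disjoint_left]
      intro x hx hx'
      obtain ⟨u, hu, rfl⟩ := Multiset.mem_map.1 hx
      obtain ⟨v, hv, e⟩ := Multiset.mem_map.1 hx'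
      have hu := Multiset.mem_filter.1 hu
      have hv := Multiset.mem_filter.1 hv
      have e1 := (hc u hu.1).head_lo hu.2
      obtain ⟨e2, e3⟩ := (hc v hv.1).head_hi (not_not.1 hv.2) (hne v hv.1)
      have := (mem_lo.1 (headD_mem hu.2)).2
      have := (mem_hi (headD_mem e3)).2
      omega

/-- `c` occurs in `M_a ⋆ M_b`. -/
def Cond (a b c : W) : Prop :=
  (∀ w ∈ LR c, Cut a.length w) ∧ LOs a.length (LR c : Multiset W) = (LR a : Multiset W) ∧ 
    HIs a.length (LR c : Multiset W) = (LR b : Multiset W)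

/-- multiset of letters -/
def lettersM (G : Multiset W) : Multiset ℕ := (G.map (fun w : W => Multiset.ofList w)).sum

theorem lettersM_LR (a : W) : lettersM (LR a : Multiset W) = (a : Multiset ℕ) := by
  have h : ∀ F : List W, lettersM (F : Multiset W) = (wordOf F : Multiset ℕ) := by
    intro F
    induction F with
    | nil => simp [lettersM, wordOf]
    | cons w F ih => 
      simp [lettersM, wordOf] at ih ⊢
      rw [ih]
      rw [← Multiset.coe_add, add_comm]
  rw [h, wordOf_LR]

theorem lettersM_filter (G : Multiset W) : lettersM (G.filter (fun w => w ≠ [])) = lettersM G := by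
  induction G using Multiset.induction_on with
  | empty => simp
  | cons w G ih => 
    by_cases h : w = []
    · subst h
      simp [lettersM] at ih ⊢
      exact ih
    · simp [lettersM, h] at ih ⊢
      exact ih

theorem lettersM_cut {m : ℕ} {G : Multiset W} (hc : ∀ w ∈ G, Cut m w) : 
    lettersM G = lettersM (G.map (lo m)) + (lettersM (G.map (hi m))).map (fun x => x + m) := by
  induction G using Multiset.induction_on with
  | empty => simp [lettersM]
  | cons w G ih => 
    have ih := ih (fun w hw => hc w (by simp [hw]))
    have e := (hc w (by simp)).eq
    simp only [lettersM, Multiset.map_cons, Multiset.sum_cons, Multiset.map_add] at ih ⊢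
    rw [ih]
    conv_lhs => rw [← e]
    rw [← Multiset.coe_add]
    simp only [shiftW, ← Multiset.map_coe]
    abel

theorem Cond.letters {a b c : W} (h : Cond a b c) : 
    (c : Multiset ℕ) = (a : Multiset ℕ) + (b : Multiset ℕ).map (fun x => x + a.length) := by
  obtain ⟨h1, h2, h3⟩ := h
  rw [← lettersM_LR c, lettersM_cut (m := a.length) (by simpa using h1)]
  rw [← lettersM_filter, ← lettersM_filter (Multiset.map (hi a.length) _)]
  rw [LOs] at h2
  rw [HIs] at h3
  rw [h2, h3, lettersM_LR, lettersM_LR]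

theorem Cond.length {a b c : W} (h : Cond a b c) : c.length = a.length + b.length := by
  have := congrArg Multiset.card h.letters
  simpa using this

theorem Cond_assoc (a b c d : W) : 
    (∃ e, Cond a b e ∧ Cond e c d) ↔ (∃ f, Cond b c f ∧ Cond a f d) := by
  constructor
  · rintro ⟨e, he, hd⟩
    have hl := he.length
    obtain ⟨e1, e2, e3⟩ := he
    obtain ⟨d1, d2, d3⟩ := hd
    rw [hl] at d1 d2 d3
    have hcut : ∀ w ∈ LR d, Cut a.length w ∧ Cut b.length (hi a.length w) := by
      intro w hw
      rw [← cut_three]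
      refine ⟨d1 w hw, ?_⟩
      by_cases hn : lo (a.length + b.length) w = []
      · rw [hn]; exact List.Pairwise.nil
      · apply e1
        have : lo (a.length + b.length) w ∈ (LR e : Multiset W) := by
          rw [← d2, mem_LOs]
          exact ⟨⟨w, by simpa using hw, rfl⟩, hn⟩
        simpa using this
    have hB : LOs b.length (HIs a.length (LR d : Multiset W)) = (LR b : Multiset W) := by
      rw [LOs_HIs, d2, e3]
    have hC : HIs b.length (HIs a.length (LR d : Multiset W)) = (LR c : Multiset W) := by
      rw [HIs_HIs, d3]
    have hcutG : ∀ w ∈ HIs a.length (LR d : Multiset W), Cut b.length w := by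
      intro w hw
      obtain ⟨⟨v, hv, rfl⟩, _⟩ := mem_HIs.1 hw
      exact (hcut v (by simpa using hv)).2
    have hv : ValidM (HIs a.length (LR d : Multiset W)) := by
      apply valid_of_parts (n := b.length)
      · intro w hw; exact (mem_HIs.1 hw).2
      · exact hcutG
      · rw [hB]; exact (LR_good b).valid
      · rw [hC]; exact (LR_good c).valid
    obtain ⟨f, hf⟩ := exists_of_valid hv
    refine ⟨f, ⟨?_, ?_, ?_⟩, ?_, ?_, ?_⟩
    · intro w hw
      apply hcutG
      rw [← hf]; simpa using hw
    · rw [hf, hB]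
    · rw [hf, hC]
    · intro w hw; exact (hcut w hw).1
    · rw [← LOs_LOs a.length b.length, d2, e2]
    · exact hf.symm
  · rintro ⟨f, hf, hd⟩
    obtain ⟨f1, f2, f3⟩ := hf
    obtain ⟨d1, d2, d3⟩ := hd
    have hcut : ∀ w ∈ LR d, Cut (a.length + b.length) w ∧ 
        Cut a.length (lo (a.length + b.length) w) := by
      intro w hw
      rw [cut_three]
      refine ⟨d1 w hw, ?_⟩
      by_cases hn : hi a.length w = []
      · rw [hn]; exact List.Pairwise.nil
      · apply f1
        have : hi a.length w ∈ (LR f : Multiset W) := by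
          rw [← d3, mem_HIs]
          exact ⟨⟨w, by simpa using hw, rfl⟩, hn⟩
        simpa using this
    have hv : ValidM (LOs (a.length + b.length) (LR d : Multiset W)) := by
      apply valid_LOs (LR_good d).valid
      intro w hw
      exact (hcut w (by simpa using hw)).1
    obtain ⟨e, he⟩ := exists_of_valid hv
    have hce : Cond a b e := by
      refine ⟨?_, ?_, ?_⟩
      · intro w hw
        have : w ∈ (LR e : Multiset W) := by simpa using hw
        rw [he] at this
        obtain ⟨⟨v, hv, rfl⟩, _⟩ := mem_LOs.1 this
        exact (hcut v (by simpa using hv)).2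
      · rw [he, LOs_LOs, d2]
      · rw [he, ← LOs_HIs, d3, f2]
    refine ⟨e, hce, ?_, ?_, ?_⟩
    · rw [hce.length]
      intro w hw; exact (hcut w hw).1
    · rw [hce.length, he]
    · rw [hce.length, ← HIs_HIs, d3, f3]

theorem Cond.left_unique {a a' b b' c : W} (h : Cond a b c) (h' : Cond a' b' c) 
    (e : a.length = a'.length) : a = a' := by
  apply LR_coe_inj
  rw [← h.2.1, ← h'.2.1, e]

theorem Cond.right_unique {a a' b b' c : W} (h : Cond a b c) (h' : Cond a' b' c) 
    (e : a.length = a'.length) : b = b' := by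
  apply LR_coe_inj
  rw [← h.2.2, ← h'.2.2, e]

/-! parking functions -/

theorem isPF_iff (a : W) : IsPF a ↔ (∀ x ∈ a, 1 ≤ x) ∧ 
    ∀ k ≤ a.length, k ≤ a.countP (fun x => decide (x ≤ k)) := by
  unfold IsPF
  refine and_congr_right fun _ => ?_
  have hp := List.perm_insertionSort (· ≤ ·) a
  have hs : (a.insertionSort (· ≤ ·)).Pairwise (· ≤ ·) := List.pairwise_insertionSort _ a
  set s := a.insertionSort (· ≤ ·) with hsdef
  rw [← hp.length_eq]
  have hc : ∀ k, a.countP (fun x => decide (x ≤ k)) = s.countP (fun x => decide (x ≤ k)) := 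
    fun k => (hp.countP_eq _).symm
  simp only [hc]
  clear hc hp hsdef
  constructor
  · intro h k hk
    rcases Nat.eq_zero_or_pos k with rfl | hk0
    · simp
    have h1 : (s.take k).countP (fun x => decide (x ≤ k)) = (s.take k).length := by
      rw [List.countP_eq_length]
      intro x hx
      obtain ⟨i, hi, rfl⟩ := List.mem_iff_getElem.1 hx
      simp at hi
      have := h i (by omega)
      rw [List.getD_eq_getElem _ _ (by omega)] at this
      simp
      omega
    have h2 := List.Sublist.countP_le (p := fun x => decide (x ≤ k)) (List.take_sublist k s)
    rw [h1] at h2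
    simp at h2
    omega
  · intro h i hi
    by_contra hlt
    have h1 := h (i+1) (by omega)
    rw [← List.take_append_drop i s, List.countP_append] at h1
    have h2 : (s.drop i).countP (fun x => decide (x ≤ i + 1)) = 0 := by
      rw [List.countP_eq_zero]
      intro x hx
      obtain ⟨j, hj, rfl⟩ := List.mem_iff_getElem.1 hx
      simp at hj
      rw [List.getD_eq_getElem _ _ hi] at hlt
      have := List.pairwise_iff_getElem.1 hs
      simp
      rcases Nat.eq_zero_or_pos j with rfl | hj0
      · simp; omega
      · have := this i (i + j) (by omega) (by omega) (by omega)
        omega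
    have h3 := List.countP_le_length (p := fun x => decide (x ≤ i + 1)) (l := s.take i)
    simp at h3
    omega

theorem IsPF.le_length {a : W} (h : IsPF a) : ∀ x ∈ a, x ≤ a.length := by
  have h1 := ((isPF_iff a).1 h).2 a.length le_rfl
  have h2 := le_antisymm h1 (List.countP_le_length)
  have h3 := List.countP_eq_length.1 h2.symm
  simpa using h3

theorem Cond.isPF {a b c : W} (h : Cond a b c) (ha : IsPF a) (hb : IsPF b) : IsPF c := by
  have hp : c.Perm (a ++ b.map (fun x => x + a.length)) := by
    have := h.letters
    rw [Multiset.map_coe, Multiset.coe_add] at this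
    exact Multiset.coe_eq_coe.1 this
  rw [isPF_iff] at ha hb ⊢
  constructor
  · intro x hx
    rcases List.mem_append.1 (hp.mem_iff.1 hx) with hx | hx
    · exact ha.1 x hx
    · obtain ⟨y, hy, rfl⟩ := List.mem_map.1 hx
      have := hb.1 y hy
      omega
  · intro k hk
    rw [hp.countP_eq, List.countP_append, List.countP_map]
    rw [h.length] at hk
    by_cases hka : k ≤ a.length
    · have := ha.2 k hka
      omega
    · have h1 := ha.2 a.length le_rfl
      have h2 : a.countP (fun x => decide (x ≤ a.length)) ≤ a.countP (fun x => decide (x ≤ k)) := by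
        apply List.countP_mono_left
        intro x _ hx
        simp at hx ⊢
        omega
      have h3 := hb.2 (k - a.length) (by omega)
      have h4 : b.countP (fun x => decide (x ≤ k - a.length)) ≤ 
          b.countP ((fun x => decide (x ≤ k)) ∘ fun x => x + a.length) := by
        apply List.countP_mono_left
        intro x _ hx
        simp at hx ⊢
        omega
      omega

theorem isPF_nil : IsPF [] := by
  rw [isPF_iff]; simp

theorem LR_mem_letters {a w : W} (hw : w ∈ LR a) : ∀ x ∈ w, x ∈ a :=
  segs_mem_subset a w (by simpa [LR] using hw)

theorem LR_toFinset_val (a : W) : (LR a).toFinset.val = (LR a : Multiset W) := by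
  rw [List.toFinset_val, (LR_good a).nodup.dedup]

theorem shiftW_inj (m : ℕ) : Function.Injective (shiftW m) := 
  List.map_injective_iff.2 (add_left_injective m)

theorem shiftF_toFinset_val (m : ℕ) (b : W) : 
    (shiftF m (LR b)).toFinset.val = (LR b : Multiset W).map (shiftW m) := by
  rw [List.toFinset_val, List.Nodup.dedup]
  · rfl
  · exact (LR_good b).nodup.map (shiftW_inj m)


theorem X_facts {a b : W} (ha : IsPF a) (hb : IsPF b) {u : W} (hu : u ∈ (LR a).toFinset) : 
    u ≠ [] ∧ lo a.length u = u ∧ hi a.length u = [] := by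
  have hu : u ∈ LR a := by simpa using hu
  have h : ∀ x ∈ u, x ≤ a.length := fun x hx => ha.le_length x (LR_mem_letters hu x hx)
  exact ⟨((LR_good a).1 u hu).1, lo_of_le h, hi_of_le h⟩

theorem Y_facts {a b : W} (ha : IsPF a) (hb : IsPF b) {y : W} (hy : y ∈ (shiftF a.length (LR b)).toFinset) : 
    y ≠ [] ∧ lo a.length y = [] ∧ hi a.length y ∈ LR b ∧ shiftW a.length (hi a.length y) = y := by
  have hy : y ∈ shiftF a.length (LR b) := by simpa using hy
  obtain ⟨w, hw, rfl⟩ := List.mem_map.1 hy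
  have h : ∀ x ∈ w, 1 ≤ x := fun x hx => hb.1 x (LR_mem_letters hw x hx)
  have h2 := ((LR_good b).1 w hw).1
  rw [hi_shift h]
  refine ⟨by simpa [shiftW] using h2, lo_shift h, hw, rfl⟩

theorem Y_hi_ne {a b : W} (ha : IsPF a) (hb : IsPF b) {y : W} (hy : y ∈ (shiftF a.length (LR b)).toFinset) : hi a.length y ≠ [] := by
  obtain ⟨h1, h2, h3, h4⟩ := Y_facts ha hb hy
  exact ((LR_good b).1 _ h3).1

theorem Rset_facts {a b : W} (ha : IsPF a) (hb : IsPF b) {Θ : Finset (W × W)} (h : Θ ∈ Rset a b) : 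
    (∀ p ∈ Θ, p.1 ∈ (LR a).toFinset ∧ p.2 ∈ (shiftF a.length (LR b)).toFinset) ∧
    (∀ p ∈ Θ, ∀ q ∈ Θ, (p.1 = q.1 ∨ p.2 = q.2) → p = q) := by
  rw [Rset, Finset.mem_filter, Finset.mem_powerset] at h
  refine ⟨fun p hp => ?_, h.2⟩
  have := h.1 hp
  rwa [Finset.mem_product] at this

theorem pair_facts {a b : W} (ha : IsPF a) (hb : IsPF b) {u y : W} (hu : u ∈ (LR a).toFinset) 
    (hy : y ∈ (shiftF a.length (LR b)).toFinset) : 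
    lo a.length (u ++ y) = u ∧ hi a.length (u ++ y) = hi a.length y := by
  obtain ⟨h1, h2, h3⟩ := X_facts ha hb hu
  obtain ⟨k1, k2, k3, k4⟩ := Y_facts ha hb hy
  rw [lo_append, hi_append, h2, h3, k2]
  simp

theorem glue_val {a b : W} (ha : IsPF a) (hb : IsPF b) {Θ : Finset (W × W)} (h : Θ ∈ Rset a b) : 
    (glueSet (LR a).toFinset (shiftF a.length (LR b)).toFinset Θ).val = 
    Θ.val.map (fun p => p.1 ++ p.2) + 
    ((LR a).toFinset.filter (fun u => ∀ p ∈ Θ, p.1 ≠ u)).val + 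
    ((shiftF a.length (LR b)).toFinset.filter (fun w => ∀ p ∈ Θ, p.2 ≠ w)).val := by
  obtain ⟨h1, h2⟩ := Rset_facts ha hb h
  have hinj : Set.InjOn (fun p : W × W => p.1 ++ p.2) (Θ : Set (W × W)) := by
    intro p hp q hq e
    have hp := h1 p hp
    have hq := h1 q hq
    apply h2 p (by assumption) q (by assumption)
    left
    have e1 := congrArg (lo a.length) e
    simpa [pair_facts ha hb hp.1 hp.2, pair_facts ha hb hq.1 hq.2] using e1
  rw [← Finset.image_val_of_injOn hinj]
  have d1 : Disjoint (Θ.image (fun p => p.1 ++ p.2)) 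
      ((LR a).toFinset.filter (fun u => ∀ p ∈ Θ, p.1 ≠ u)) := by
    rw [Finset.disjoint_left]
    intro w hw hw'
    obtain ⟨p, hp, rfl⟩ := Finset.mem_image.1 hw
    have hp' := h1 p hp
    have e1 := (pair_facts ha hb hp'.1 hp'.2).2
    rw [(X_facts ha hb (Finset.mem_filter.1 hw').1).2.2] at e1
    exact Y_hi_ne ha hb hp'.2 e1.symm
  have d2 : Disjoint (Θ.image (fun p => p.1 ++ p.2) ∪ 
      ((LR a).toFinset.filter (fun u => ∀ p ∈ Θ, p.1 ≠ u)))
      ((shiftF a.length (LR b)).toFinset.filter (fun w => ∀ p ∈ Θ, p.2 ≠ w)) := by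
    rw [Finset.disjoint_left]
    intro w hw hw'
    have e2 := (Y_facts ha hb (Finset.mem_filter.1 hw').1).2.1
    rcases Finset.mem_union.1 hw with hw | hw
    · obtain ⟨p, hp, rfl⟩ := Finset.mem_image.1 hw
      have hp' := h1 p hp
      have e1 := (pair_facts ha hb hp'.1 hp'.2).1
      rw [e2] at e1
      exact (X_facts ha hb hp'.1).1 e1.symm
    · have := X_facts ha hb (Finset.mem_filter.1 hw).1
      rw [this.2.1] at e2
      exact this.1 e2
  rw [glueSet, ← Finset.disjUnion_eq_union _ _ d2, Finset.disjUnion_val, 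
    ← Finset.disjUnion_eq_union _ _ d1, Finset.disjUnion_val]

theorem glue_mem {a b : W} (ha : IsPF a) (hb : IsPF b) {Θ : Finset (W × W)} (h : Θ ∈ Rset a b) {w : W} 
    (hw : w ∈ glueSet (LR a).toFinset (shiftF a.length (LR b)).toFinset Θ) : 
    (∃ p ∈ Θ, w = p.1 ++ p.2) ∨ (w ∈ (LR a).toFinset) ∨ 
      (w ∈ (shiftF a.length (LR b)).toFinset) := by
  rw [glueSet, Finset.mem_union, Finset.mem_union] at hw
  rcases hw with (hw | hw) | hw
  · obtain ⟨p, hp, rfl⟩ := Finset.mem_image.1 hw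
    exact Or.inl ⟨p, hp, rfl⟩
  · exact Or.inr (Or.inl (Finset.mem_filter.1 hw).1)
  · exact Or.inr (Or.inr (Finset.mem_filter.1 hw).1)

theorem cut_of_eq {m : ℕ} {u v : W} (hu : ∀ x ∈ u, x ≤ m) (hv : ∀ x ∈ v, m < x) : 
    Cut m (u ++ v) := by
  rw [Cut, List.pairwise_append]
  refine ⟨?_, ?_, ?_⟩
  · exact List.pairwise_of_forall_mem_list (fun x hx y hy _ => hu x hx)
  · exact List.pairwise_of_forall_mem_list (fun x hx y hy h => absurd (hv y hy) (by omega))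
  · intro x hx y hy _
    exact hu x hx

theorem X_le {a b : W} (ha : IsPF a) (hb : IsPF b) {u : W} (hu : u ∈ (LR a).toFinset) : ∀ x ∈ u, x ≤ a.length :=
  fun x hx => ha.le_length x (LR_mem_letters (by simpa using hu) x hx)

theorem Y_gt {a b : W} (ha : IsPF a) (hb : IsPF b) {y : W} (hy : y ∈ (shiftF a.length (LR b)).toFinset) : ∀ x ∈ y, a.length < x := by
  obtain ⟨h1, h2, h3, h4⟩ := Y_facts ha hb hy
  intro x hx
  rw [← h4] at hx
  obtain ⟨z, hz, rfl⟩ := List.mem_map.1 hx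
  have := (mem_hi hz).2
  omega

theorem glue_cut {a b : W} (ha : IsPF a) (hb : IsPF b) {Θ : Finset (W × W)} (h : Θ ∈ Rset a b) {w : W} 
    (hw : w ∈ glueSet (LR a).toFinset (shiftF a.length (LR b)).toFinset Θ) : 
    w ≠ [] ∧ Cut a.length w := by
  obtain ⟨h1, h2⟩ := Rset_facts ha hb h
  rcases glue_mem ha hb h hw with ⟨p, hp, rfl⟩ | hw | hw
  · have hp := h1 p hp
    refine ⟨?_, cut_of_eq (X_le ha hb hp.1) (Y_gt ha hb hp.2)⟩
    have := (X_facts ha hb hp.1).1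
    simp [this]
  · refine ⟨(X_facts ha hb hw).1, ?_⟩
    have := cut_of_eq (X_le ha hb hw) (v := []) (by simp)
    simpa using this
  · refine ⟨(Y_facts ha hb hw).1, ?_⟩
    have := cut_of_eq (u := []) (by simp) (Y_gt ha hb hw)
    simpa using this

theorem filter_zero {s : Multiset W} {f : W → W} (h : ∀ w ∈ s, f w = []) : 
    (s.map f).filter (fun w => w ≠ []) = 0 := by
  rw [Multiset.filter_eq_nil]
  intro w hw
  obtain ⟨v, hv, rfl⟩ := Multiset.mem_map.1 hw
  simp [h v hv]

theorem filter_all {s : Multiset W} {f : W → W} (h : ∀ w ∈ s, f w ≠ []) : 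
    (s.map f).filter (fun w => w ≠ []) = s.map f := by
  rw [Multiset.filter_eq_self]
  intro w hw
  obtain ⟨v, hv, rfl⟩ := Multiset.mem_map.1 hw
  exact h v hv

theorem glue_LOs {a b : W} (ha : IsPF a) (hb : IsPF b) {Θ : Finset (W × W)} (h : Θ ∈ Rset a b) : 
    LOs a.length (glueSet (LR a).toFinset (shiftF a.length (LR b)).toFinset Θ).val = 
    (LR a : Multiset W) := by
  obtain ⟨h1, h2⟩ := Rset_facts ha hb h
  rw [glue_val ha hb h, LOs, Multiset.map_add, Multiset.map_add, Multiset.filter_add, 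
    Multiset.filter_add, 
    filter_zero (f := lo a.length) 
      (s := ((shiftF a.length (LR b)).toFinset.filter (fun w => ∀ p ∈ Θ, p.2 ≠ w)).val), add_zero, 
    filter_all (f := lo a.length) (s := Finset.val _), 
    filter_all (f := lo a.length), Multiset.map_map]
  · have e1 : Θ.val.map (lo a.length ∘ fun p => p.1 ++ p.2) = Θ.val.map Prod.fst := by
      apply Multiset.map_congr rfl
      intro p hp
      have hp := h1 p hp
      exact (pair_facts ha hb hp.1 hp.2).1
    have e2 : ((LR a).toFinset.filter (fun u => ∀ p ∈ Θ, p.1 ≠ u)).val.map (lo a.length) = 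
        ((LR a).toFinset.filter (fun u => ∀ p ∈ Θ, p.1 ≠ u)).val := by
      conv_rhs => rw [← Multiset.map_id' (Finset.val _)]
      apply Multiset.map_congr rfl
      intro p hp
      exact (X_facts ha hb (Finset.mem_filter.1 hp).1).2.1
    have e3 : Θ.val.map Prod.fst = 
        ((LR a).toFinset.filter (fun u => ¬ ∀ p ∈ Θ, p.1 ≠ u)).val := by
      rw [← Finset.image_val_of_injOn]
      · congr 1
        ext u
        simp only [Finset.mem_image, Finset.mem_filter, not_forall, not_not]
        constructor
        · rintro ⟨p, hp, rfl⟩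
          exact ⟨(h1 p hp).1, p, hp, rfl⟩
        · rintro ⟨_, p, hp, rfl⟩
          exact ⟨p, hp, rfl⟩
      · intro p hp q hq e
        exact h2 p hp q hq (Or.inl e)
    rw [e1, e2, e3, add_comm, Finset.filter_val, Finset.filter_val, Multiset.filter_add_not, 
      LR_toFinset_val]
  · intro w hw
    obtain ⟨p, hp, rfl⟩ := Multiset.mem_map.1 hw
    have hp := h1 p hp
    rw [(pair_facts ha hb hp.1 hp.2).1]
    exact (X_facts ha hb hp.1).1
  · intro w hw
    have := X_facts ha hb (Finset.mem_filter.1 hw).1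
    rw [this.2.1]; exact this.1
  · intro w hw
    exact (Y_facts ha hb (Finset.mem_filter.1 hw).1).2.1

theorem glue_HIs {a b : W} (ha : IsPF a) (hb : IsPF b) {Θ : Finset (W × W)} (h : Θ ∈ Rset a b) : 
    HIs a.length (glueSet (LR a).toFinset (shiftF a.length (LR b)).toFinset Θ).val = 
    (LR b : Multiset W) := by
  obtain ⟨h1, h2⟩ := Rset_facts ha hb h
  rw [glue_val ha hb h, HIs, Multiset.map_add, Multiset.map_add, Multiset.filter_add, 
    Multiset.filter_add, 
    filter_zero (f := hi a.length) 
      (s := ((LR a).toFinset.filter (fun u => ∀ p ∈ Θ, p.1 ≠ u)).val), add_zero, 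
    filter_all (f := hi a.length) (s := Finset.val _), 
    filter_all (f := hi a.length), Multiset.map_map]
  · have e1 : Θ.val.map (hi a.length ∘ fun p => p.1 ++ p.2) = 
        (Θ.val.map Prod.snd).map (hi a.length) := by
      rw [Multiset.map_map]
      apply Multiset.map_congr rfl
      intro p hp
      have hp := h1 p hp
      exact (pair_facts ha hb hp.1 hp.2).2
    have e3 : Θ.val.map Prod.snd = 
        ((shiftF a.length (LR b)).toFinset.filter (fun u => ¬ ∀ p ∈ Θ, p.2 ≠ u)).val := by
      rw [← Finset.image_val_of_injOn]
      · congr 1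
        ext u
        simp only [Finset.mem_image, Finset.mem_filter, not_forall, not_not]
        constructor
        · rintro ⟨p, hp, rfl⟩
          exact ⟨(h1 p hp).2, p, hp, rfl⟩
        · rintro ⟨_, p, hp, rfl⟩
          exact ⟨p, hp, rfl⟩
      · intro p hp q hq e
        exact h2 p hp q hq (Or.inr e)
    rw [e1, e3, add_comm, ← Multiset.map_add, Finset.filter_val, Finset.filter_val, 
      Multiset.filter_add_not, shiftF_toFinset_val, Multiset.map_map]
    conv_rhs => rw [← Multiset.map_id' (LR b : Multiset W)]
    apply Multiset.map_congr rfl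
    intro w hw
    exact hi_shift fun x hx => hb.1 x (LR_mem_letters (by simpa using hw) x hx)
  · intro w hw
    obtain ⟨p, hp, rfl⟩ := Multiset.mem_map.1 hw
    have hp := h1 p hp
    rw [(pair_facts ha hb hp.1 hp.2).2]
    exact Y_hi_ne ha hb hp.2
  · intro w hw
    exact Y_hi_ne ha hb (Finset.mem_filter.1 hw).1
  · intro w hw
    exact (X_facts ha hb (Finset.mem_filter.1 hw).1).2.2

theorem glue_valid {a b : W} (ha : IsPF a) (hb : IsPF b) {Θ : Finset (W × W)} (h : Θ ∈ Rset a b) : 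
    ValidM (glueSet (LR a).toFinset (shiftF a.length (LR b)).toFinset Θ).val := by
  apply valid_of_parts (n := a.length)
  · intro w hw
    exact (glue_cut ha hb h hw).1
  · intro w hw
    exact (glue_cut ha hb h hw).2
  · rw [glue_LOs ha hb h]; exact (LR_good a).valid
  · rw [glue_HIs ha hb h]; exact (LR_good b).valid

theorem mTheta_LR {a b : W} (ha : IsPF a) (hb : IsPF b) {Θ : Finset (W × W)} (h : Θ ∈ Rset a b) : 
    (LR (mTheta a b Θ) : Multiset W) = 
    (glueSet (LR a).toFinset (shiftF a.length (LR b)).toFinset Θ).val :=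
  LR_wordOfSet_coe (glue_valid ha hb h)

theorem mTheta_cond {a b : W} (ha : IsPF a) (hb : IsPF b) {Θ : Finset (W × W)} (h : Θ ∈ Rset a b) : Cond a b (mTheta a b Θ) := by
  refine ⟨?_, ?_, ?_⟩
  · intro w hw
    have hw : w ∈ (LR (mTheta a b Θ) : Multiset W) := by simpa using hw
    rw [mTheta_LR ha hb h] at hw
    exact (glue_cut ha hb h hw).2
  · rw [mTheta_LR ha hb h, glue_LOs ha hb h]
  · rw [mTheta_LR ha hb h, glue_HIs ha hb h]

/-- recover the matching -/
noncomputable def thetaOf (m : ℕ) (c : W) : Finset (W × W) :=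
  ((LR c).toFinset.filter (fun w => lo m w ≠ [] ∧ hi m w ≠ [])).image 
    (fun w => (lo m w, shiftW m (hi m w)))

theorem thetaOf_mTheta {a b : W} (ha : IsPF a) (hb : IsPF b) {Θ : Finset (W × W)} (h : Θ ∈ Rset a b) : 
    thetaOf a.length (mTheta a b Θ) = Θ := by
  have e : (LR (mTheta a b Θ)).toFinset = 
      glueSet (LR a).toFinset (shiftF a.length (LR b)).toFinset Θ := by
    apply Finset.val_injective
    rw [LR_toFinset_val, mTheta_LR ha hb h]
  obtain ⟨h1, h2⟩ := Rset_facts ha hb h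
  ext p
  rw [thetaOf, e, Finset.mem_image]
  constructor
  · rintro ⟨w, hw, rfl⟩
    rw [Finset.mem_filter] at hw
    rcases glue_mem ha hb h hw.1 with ⟨p, hp, rfl⟩ | hw' | hw'
    · have hp' := h1 p hp
      obtain ⟨k1, k2⟩ := pair_facts ha hb hp'.1 hp'.2
      rw [k1, k2, (Y_facts ha hb hp'.2).2.2.2]
      exact hp
    · exact absurd (X_facts ha hb hw').2.2 hw.2.2
    · exact absurd (Y_facts ha hb hw').2.1 hw.2.1
  · intro hp
    have hp' := h1 p hp
    obtain ⟨k1, k2⟩ := pair_facts ha hb hp'.1 hp'.2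
    refine ⟨p.1 ++ p.2, Finset.mem_filter.2 ⟨?_, ?_, ?_⟩, ?_⟩
    · rw [glueSet, Finset.mem_union, Finset.mem_union]
      left; left
      exact Finset.mem_image.2 ⟨p, hp, rfl⟩
    · rw [k1]; exact (X_facts ha hb hp'.1).1
    · rw [k2]; exact Y_hi_ne ha hb hp'.2
    · rw [k1, k2, (Y_facts ha hb hp'.2).2.2.2]

theorem mTheta_injOn {a b : W} (ha : IsPF a) (hb : IsPF b) : Set.InjOn (mTheta a b) (Rset a b : Set (Finset (W × W))) := by
  intro Θ h Θ' h' e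
  rw [← thetaOf_mTheta ha hb h, ← thetaOf_mTheta ha hb h', e]

theorem Cond.lo_inj {a b : W} {c : W} (h : Cond a b c) {u v : W} (hu : u ∈ LR c) (hv : v ∈ LR c) 
    (hne : lo a.length u ≠ []) (e : lo a.length u = lo a.length v) : u = v := by
  apply (LR_good c).inj hu hv
  rw [(h.1 u hu).head_lo hne, (h.1 v hv).head_lo (e ▸ hne), e]

theorem Cond.hi_inj {a b : W} {c : W} (h : Cond a b c) {u v : W} (hu : u ∈ LR c) (hv : v ∈ LR c) 
    (hne : hi a.length u ≠ []) (e : hi a.length u = hi a.length v) : u = v := by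
  have h1 : (HIs a.length (LR c : Multiset W)).Nodup := by
    rw [h.2.2]; exact (LR_good b).valid.nodup
  rw [HIs, Multiset.filter_map] at h1
  refine Multiset.inj_on_of_nodup_map h1 u ?_ v ?_ e
  · exact Multiset.mem_filter.2 ⟨by simpa using hu, hne⟩
  · exact Multiset.mem_filter.2 ⟨by simpa using hv, fun h3 => hne (e.trans h3)⟩

theorem Cond.lo_mem {a b : W} {c : W} (h : Cond a b c) {u : W} : 
    u ∈ (LR a).toFinset ↔ (∃ w ∈ LR c, lo a.length w = u) ∧ u ≠ [] := by
  have : u ∈ (LR a).toFinset ↔ u ∈ (LR a : Multiset W) := by simp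
  rw [this, ← h.2.1, mem_LOs]
  simp

theorem Cond.hi_mem {a b : W} {c : W} (h : Cond a b c) {u : W} : 
    u ∈ (shiftF a.length (LR b)).toFinset ↔ 
      (∃ w ∈ LR c, hi a.length w ≠ [] ∧ shiftW a.length (hi a.length w) = u) := by
  have : u ∈ (shiftF a.length (LR b)).toFinset ↔ 
      ∃ w ∈ (LR b : Multiset W), shiftW a.length w = u := by simp [shiftF]
  rw [this, ← h.2.2]
  simp only [mem_HIs]
  constructor
  · rintro ⟨w, ⟨⟨v, hv, rfl⟩, hne⟩, rfl⟩
    exact ⟨v, by simpa using hv, hne, rfl⟩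
  · rintro ⟨v, hv, hne, rfl⟩
    exact ⟨_, ⟨⟨v, by simpa using hv, rfl⟩, hne⟩, rfl⟩

theorem Cond.thetaOf_mem {a b : W} {c : W} (h : Cond a b c) : thetaOf a.length c ∈ Rset a b := by
  rw [Rset, Finset.mem_filter, Finset.mem_powerset]
  constructor
  · intro p hp
    obtain ⟨w, hw, rfl⟩ := Finset.mem_image.1 hp
    obtain ⟨hw, h1, h2⟩ := Finset.mem_filter.1 hw
    have hw : w ∈ LR c := by simpa using hw
    rw [Finset.mem_product]
    exact ⟨h.lo_mem.2 ⟨⟨w, hw, rfl⟩, h1⟩, h.hi_mem.2 ⟨w, hw, h2, rfl⟩⟩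
  · intro p hp q hq e
    obtain ⟨w, hw, rfl⟩ := Finset.mem_image.1 hp
    obtain ⟨hw, h1, h2⟩ := Finset.mem_filter.1 hw
    have hw : w ∈ LR c := by simpa using hw
    obtain ⟨v, hv, rfl⟩ := Finset.mem_image.1 hq
    obtain ⟨hv, k1, k2⟩ := Finset.mem_filter.1 hv
    have hv : v ∈ LR c := by simpa using hv
    rcases e with e | e
    · rw [h.lo_inj hw hv h1 e]
    · rw [h.hi_inj hw hv h2 (shiftW_inj _ e)]

theorem Cond.mTheta_thetaOf {a b : W} {c : W} (h : Cond a b c) : mTheta a b (thetaOf a.length c) = c := by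
  rw [mTheta]
  conv_rhs => rw [← wordOfSet_LR c]
  congr 1
  have mem_th : ∀ w ∈ LR c, lo a.length w ≠ [] → hi a.length w ≠ [] → 
      (lo a.length w, shiftW a.length (hi a.length w)) ∈ thetaOf a.length c := by
    intro w hw h1 h2
    exact Finset.mem_image.2 ⟨w, Finset.mem_filter.2 ⟨by simpa using hw, h1, h2⟩, rfl⟩
  ext w
  rw [glueSet, Finset.mem_union, Finset.mem_union, List.mem_toFinset, Finset.mem_image, 
    Finset.mem_filter, Finset.mem_filter]
  constructor
  · rintro ((⟨p, hp, rfl⟩ | ⟨hw, hm⟩) | ⟨hw, hm⟩)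
    · obtain ⟨w, hw, rfl⟩ := Finset.mem_image.1 hp
      have hw : w ∈ LR c := by simpa using (Finset.mem_filter.1 hw).1
      simp only
      rw [(h.1 w hw).eq]
      exact hw
    · obtain ⟨⟨v, hv, rfl⟩, hne⟩ := h.lo_mem.1 hw
      have : hi a.length v = [] := by
        by_contra h2
        exact hm _ (mem_th v hv hne h2) rfl
      have e := (h.1 v hv).eq
      rw [this] at e
      simp [shiftW] at e
      rw [e]; exact hv
    · obtain ⟨v, hv, hne, rfl⟩ := h.hi_mem.1 hw
      have : lo a.length v = [] := by
        by_contra h2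
        exact hm _ (mem_th v hv h2 hne) rfl
      have e := (h.1 v hv).eq
      rw [this] at e
      simp at e
      rw [e]; exact hv
  · intro hw
    have e := (h.1 w hw).eq
    have hne := ((LR_good c).1 w hw).1
    by_cases h1 : lo a.length w = []
    · right
      rw [h1, List.nil_append] at e
      have h2 : hi a.length w ≠ [] := by
        intro h2; rw [h2] at e; exact hne e.symm
      refine ⟨h.hi_mem.2 ⟨w, hw, h2, e⟩, ?_⟩
      intro p hp e2
      obtain ⟨v, hv, rfl⟩ := Finset.mem_image.1 hp
      obtain ⟨hv, k1, k2⟩ := Finset.mem_filter.1 hv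
      have hv : v ∈ LR c := by simpa using hv
      have := h.hi_inj hw hv h2 (shiftW_inj a.length (e.trans e2.symm))
      exact k1 (this ▸ h1)
    · left
      by_cases h2 : hi a.length w = []
      · right
        rw [h2] at e
        simp [shiftW] at e
        refine ⟨h.lo_mem.2 ⟨⟨w, hw, e⟩, hne⟩, ?_⟩
        intro p hp e2
        obtain ⟨v, hv, rfl⟩ := Finset.mem_image.1 hp
        obtain ⟨hv, k1, k2⟩ := Finset.mem_filter.1 hv
        have hv : v ∈ LR c := by simpa using hv
        have := h.lo_inj hw hv h1 (e.trans e2.symm)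
        exact k2 (this ▸ h2)
      · left
        exact ⟨_, mem_th w hw h1 h2, e⟩


/-- support of `M_a ⋆ M_b` -/
noncomputable def Sset (a b : W) : Finset W := (Rset a b).image (mTheta a b)

theorem mem_Sset {a b c : W} (ha : IsPF a) (hb : IsPF b) : c ∈ Sset a b ↔ Cond a b c := by
  rw [Sset, Finset.mem_image]
  constructor
  · rintro ⟨Θ, h, rfl⟩
    exact mTheta_cond ha hb h
  · intro h
    exact ⟨_, h.thetaOf_mem, h.mTheta_thetaOf⟩

theorem mulSingle_eq (K : Type) [Field K] {a b : W} (ha : IsPF a) (hb : IsPF b) : 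
    mulSingle K a b = ∑ c ∈ Sset a b, Mb K c := by
  rw [mulSingle, Sset, Finset.sum_image (mTheta_injOn ha hb)]

theorem splitLR_nil_left (G : List W) : splitLR [] G = G := by simp [splitLR]
theorem splitLR_nil_right (F : List W) : splitLR F [] = F := by simp [splitLR]
theorem splitLR_cons (f g : W) (F G : List W) : 
    splitLR (f :: F) (g :: G) = (f ++ g) :: splitLR F G := by simp [splitLR]

theorem splitLR_getD (F G : List W) (i : ℕ) : 
    (splitLR F G).getD i [] = F.getD i [] ++ G.getD i [] := by
  induction F generalizing G i with
  | nil => simp [splitLR_nil_left]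
  | cons f F ih =>
    cases G with
    | nil => simp [splitLR_nil_right]
    | cons g G =>
      rw [splitLR_cons]
      cases i with
      | zero => simp
      | succ i => 
        have := ih G i
        simpa using this

theorem mem_splitLR {F G : List W} {v : W} (h : v ∈ splitLR F G) : 
    (∃ u ∈ F, ∃ w, v = u ++ w ∧ (w = [] ∨ w ∈ G)) ∨ v ∈ G := by
  induction F generalizing G with
  | nil => right; simpa [splitLR_nil_left] using h
  | cons f F ih =>
    cases G with
    | nil => 
      rw [splitLR_nil_right] at h
      exact Or.inl ⟨v, h, [], by simp, by simp⟩
    | cons g G =>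
      rw [splitLR_cons] at h
      rcases List.mem_cons.1 h with rfl | h
      · exact Or.inl ⟨f, by simp, g, rfl, by simp⟩
      · rcases ih h with ⟨u, hu, w, rfl, hw⟩ | h
        · refine Or.inl ⟨u, by simp [hu], w, rfl, ?_⟩
          rcases hw with hw | hw
          · exact Or.inl hw
          · exact Or.inr (by simp [hw])
        · exact Or.inr (by simp [h])

theorem good_splitLR {m : ℕ} {F G : List W} (hF : GoodL F) (hG : GoodL G)
    (h1 : ∀ u ∈ F, ∀ x ∈ u, x ≤ m) (h2 : ∀ v ∈ G, ∀ x ∈ v, m < x) : GoodL (splitLR F G) := by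
  constructor
  · intro v hv
    rcases mem_splitLR hv with ⟨u, hu, w, rfl, hw⟩ | hv
    · have hd := hF.1 u hu
      refine ⟨by simp [hd.1], fun x hx => ?_⟩
      rw [headD_append hd.1]
      rcases List.mem_append.1 hx with hx | hx
      · exact hd.2 x hx
      · rcases hw with rfl | hw
        · simp at hx
        · have := h2 w hw x hx
          have := h1 u hu _ (headD_mem hd.1)
          omega
    · exact hG.1 v hv
  · induction F generalizing G with
    | nil => rw [splitLR_nil_left]; exact hG.2
    | cons f F ih =>
      cases G with
      | nil => rw [splitLR_nil_right]; exact hF.2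
      | cons g G =>
        rw [splitLR_cons, List.pairwise_cons]
        have hfne := (hF.1 f (by simp)).1
        have hF2 := List.pairwise_cons.1 hF.2
        have hG2 := List.pairwise_cons.1 hG.2
        constructor
        · intro v hv
          rw [headD_append hfne]
          rcases mem_splitLR hv with ⟨u, hu, w, rfl, hw⟩ | hv
          · rw [headD_append (hF.1 u (by simp [hu])).1]
            exact hF2.1 u hu
          · have k1 := h1 f (by simp) _ (headD_mem hfne)
            have k2 := h2 v (by simp [hv]) _ (headD_mem (hG.1 v (by simp [hv])).1)
            omega
        · exact ih ⟨fun w hw => hF.1 w (by simp [hw]), hF2.2⟩ 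
            ⟨fun w hw => hG.1 w (by simp [hw]), hG2.2⟩ 
            (fun u hu => h1 u (by simp [hu])) (fun u hu => h2 u (by simp [hu]))

theorem good_shiftF (m : ℕ) {F : List W} (h : GoodL F) : GoodL (shiftF m F) := by
  constructor
  · intro w hw
    obtain ⟨v, hv, rfl⟩ := List.mem_map.1 hw
    have hd := h.1 v hv
    refine ⟨by simpa [shiftW] using hd.1, fun x hx => ?_⟩
    rw [headD_shift hd.1]
    obtain ⟨y, hy, rfl⟩ := List.mem_map.1 hx
    have := hd.2 y hy
    omega
  · rw [shiftF, List.pairwise_map]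
    refine h.2.imp_of_mem ?_
    intro u v hu hv huv
    rw [headD_shift (h.1 u hu).1, headD_shift (h.1 v hv).1]
    omega

theorem LR_splitProd {a b : W} (ha : IsPF a) (hb : IsPF b) : 
    LR (splitProd a b) = splitLR (LR a) (shiftF a.length (LR b)) := by
  apply LR_wordOf
  apply good_splitLR (m := a.length) (LR_good a) (good_shiftF _ (LR_good b))
  · intro u hu
    exact X_le ha hb (by simpa using hu)
  · intro u hu
    exact Y_gt ha hb (by simpa using hu)

theorem fn_splitProd {a b : W} (ha : IsPF a) (hb : IsPF b) (i : ℕ) : 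
    (LR (splitProd a b)).getD i [] = (LR a).getD i [] ++ shiftW a.length ((LR b).getD i []) := by
  rw [LR_splitProd ha hb, splitLR_getD]
  congr 1
  rw [shiftF]
  exact List.getD_map (LR b) [] (shiftW a.length)

theorem splitLR_lo (m : ℕ) (F G : List W) (hF : ∀ u ∈ F, u ≠ [] ∧ lo m u = u) 
    (hG : ∀ v ∈ G, lo m v = []) : 
    ((splitLR F G).map (lo m)).filter (fun w => decide (w ≠ [])) = F := by
  induction F generalizing G with
  | nil => 
    rw [splitLR_nil_left, List.filter_eq_nil_iff]
    intro w hw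
    obtain ⟨v, hv, rfl⟩ := List.mem_map.1 hw
    simp [hG v hv]
  | cons f F ih =>
    have hf := hF f (by simp)
    cases G with
    | nil => 
      have := ih [] (fun u hu => hF u (by simp [hu])) (by simp)
      rw [splitLR_nil_right] at this ⊢
      simp [hf.2, hf.1] at this ⊢
      exact this
    | cons g G =>
      have := ih G (fun u hu => hF u (by simp [hu])) (fun u hu => hG u (by simp [hu]))
      have hg := hG g (by simp)
      rw [splitLR_cons]
      simp [lo_append, hf.2, hf.1, hg] at this ⊢
      exact this

theorem splitLR_hi (m : ℕ) (F G : List W) (hF : ∀ u ∈ F, hi m u = []) 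
    (hG : ∀ v ∈ G, hi m v ≠ []) : 
    ((splitLR F G).map (hi m)).filter (fun w => decide (w ≠ [])) = G.map (hi m) := by
  induction F generalizing G with
  | nil => 
    rw [splitLR_nil_left, List.filter_eq_self]
    intro w hw
    obtain ⟨v, hv, rfl⟩ := List.mem_map.1 hw
    simp [hG v hv]
  | cons f F ih =>
    have hf := hF f (by simp)
    cases G with
    | nil => 
      rw [splitLR_nil_right, List.map_nil, List.filter_eq_nil_iff]
      intro w hw
      obtain ⟨v, hv, rfl⟩ := List.mem_map.1 hw
      simp [hF v hv]
    | cons g G =>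
      have := ih G (fun u hu => hF u (by simp [hu])) (fun u hu => hG u (by simp [hu]))
      have hg := hG g (by simp)
      rw [splitLR_cons]
      simp [hi_append, hf, hg] at this ⊢
      exact this

theorem LOs_coe (m : ℕ) (F : List W) : LOs m (F : Multiset W) = 
    (((F.map (lo m)).filter (fun w => decide (w ≠ [])) : List W) : Multiset W) := by
  rw [LOs, Multiset.map_coe, Multiset.filter_coe]

theorem HIs_coe (m : ℕ) (F : List W) : HIs m (F : Multiset W) = 
    (((F.map (hi m)).filter (fun w => decide (w ≠ [])) : List W) : Multiset W) := by
  rw [HIs, Multiset.map_coe, Multiset.filter_coe]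

theorem cond_splitProd {a b : W} (ha : IsPF a) (hb : IsPF b) : Cond a b (splitProd a b) := by
  rw [Cond, LR_splitProd ha hb, LOs_coe, HIs_coe, splitLR_lo, splitLR_hi]
  · refine ⟨?_, rfl, ?_⟩
    · intro v hv
      rcases mem_splitLR hv with ⟨u, hu, w, rfl, hw⟩ | hv
      · apply cut_of_eq (X_le ha hb (by simpa using hu))
        rcases hw with rfl | hw
        · simp
        · exact Y_gt ha hb (by simpa using hw)
      · have := cut_of_eq (u := []) (by simp) (Y_gt ha hb (y := v) (by simpa using hv))
        simpa using this
    · congr 1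
      rw [shiftF, List.map_map]
      conv_rhs => rw [← List.map_id (LR b)]
      apply List.map_congr_left
      intro w hw
      exact hi_shift fun x hx => hb.1 x (LR_mem_letters hw x hx)
  · intro u hu; exact (X_facts ha hb (by simpa using hu)).2.2
  · intro u hu; exact Y_hi_ne ha hb (by simpa using hu)
  · intro u hu
    have := X_facts ha hb (u := u) (by simpa using hu)
    exact ⟨this.1, this.2.1⟩
  · intro u hu; exact (Y_facts ha hb (by simpa using hu)).2.1

theorem isPF_splitProd {a b : W} (ha : IsPF a) (hb : IsPF b) : IsPF (splitProd a b) :=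
  (cond_splitProd ha hb).isPF ha hb

theorem length_splitProd {a b : W} (ha : IsPF a) (hb : IsPF b) : 
    (splitProd a b).length = a.length + b.length := (cond_splitProd ha hb).length

theorem good_ext {F G : List W} (hF : ∀ w ∈ F, w ≠ []) (hG : ∀ w ∈ G, w ≠ []) 
    (h : ∀ i, F.getD i [] = G.getD i []) : F = G := by
  induction F generalizing G with
  | nil =>
    cases G with
    | nil => rfl
    | cons g G => 
      have := h 0
      simp at this
      exact absurd this.symm (by simpa using hG g (by simp))
  | cons f F ih =>
    cases G with
    | nil => 
      have := h 0
      simp at this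
      exact absurd this (by simpa using hF f (by simp))
    | cons g G => 
      have h0 := h 0
      simp at h0
      have := ih (G := G) (fun u hu => hF u (by simp [hu])) (fun u hu => hG u (by simp [hu])) 
        (fun i => by simpa using h (i+1))
      rw [h0, this]

theorem LR_ext {a b : W} (h : ∀ i, (LR a).getD i [] = (LR b).getD i []) : a = b :=
  LR_inj (good_ext (fun w hw => ((LR_good a).1 w hw).1) (fun w hw => ((LR_good b).1 w hw).1) h)

theorem splitProd_assoc {a b c : W} (ha : IsPF a) (hb : IsPF b) (hc : IsPF c) : 
    splitProd (splitProd a b) c = splitProd a (splitProd b c) := by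
  apply LR_ext
  intro i
  rw [fn_splitProd (isPF_splitProd ha hb) hc, fn_splitProd ha hb, 
    fn_splitProd ha (isPF_splitProd hb hc), fn_splitProd hb hc, length_splitProd ha hb]
  simp [shiftW]
  intro x _
  omega

theorem splitProd_nil_right {a : W} : splitProd a [] = a := by
  rw [splitProd, segs_nil, shiftF, List.map_nil, splitLR_nil_right, wordOf_LR]

theorem splitProd_nil_left {a : W} : splitProd [] a = a := by
  rw [splitProd, segs_nil, splitLR_nil_left]
  have : shiftF ([] : W).length (LR a) = LR a := by
    rw [shiftF]
    conv_rhs => rw [← List.map_id (LR a)]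
    apply List.map_congr_left
    intro w _
    simp [shiftW]
  rw [this, wordOf_LR]

theorem lo_eq_nil_of_head {m : ℕ} {w : W} (hd : Dominated w) (h : m < w.headD 0) : lo m w = [] := by
  rw [lo, List.filter_eq_nil_iff]
  intro x hx
  have := hd.2 x hx
  simp; omega

theorem lo_getD {m : ℕ} {l : List W} (hl : GoodL l) (i : ℕ) : 
    ((l.map (lo m)).filter (fun w => decide (w ≠ []))).getD i [] = lo m (l.getD i []) := by
  induction l generalizing i with
  | nil => simp [lo_nil]
  | cons w l ih =>
    have hl2 := List.pairwise_cons.1 hl.2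
    have hl' : GoodL l := ⟨fun u hu => hl.1 u (by simp [hu]), hl2.2⟩
    by_cases h : lo m w = []
    · have hw : m < w.headD 0 := by
        by_contra hle
        have : w.headD 0 ∈ lo m w := mem_lo.2 ⟨headD_mem (hl.1 w (by simp)).1, by omega⟩
        rw [h] at this
        simp at this
      have hall : ∀ v ∈ w :: l, lo m v = [] := by
        intro v hv
        rcases List.mem_cons.1 hv with rfl | hv
        · exact h
        · apply lo_eq_nil_of_head (hl'.1 v hv)
          have := hl2.1 v hv
          omega
      have h1 : ((w :: l).map (lo m)).filter (fun w => decide (w ≠ [])) = [] := by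
        rw [List.filter_eq_nil_iff]
        intro u hu
        obtain ⟨v, hv, rfl⟩ := List.mem_map.1 hu
        simp [hall v hv]
      rw [h1]
      by_cases hi : i < (w :: l).length
      · rw [List.getD_eq_getElem _ _ hi, hall _ (List.getElem_mem hi)]
        simp
      · have h0 : (w :: l).getD i [] = [] := List.getD_eq_default _ _ (by omega)
        rw [h0]
        simp [lo_nil]
    · cases i with
      | zero => simp [h]
      | succ i => 
        have := ih hl' i
        simp [h] at this ⊢
        exact this

theorem good_lo {m : ℕ} {l : List W} (hl : GoodL l) (hc : ∀ w ∈ l, Cut m w) : 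
    GoodL ((l.map (lo m)).filter (fun w => decide (w ≠ []))) := by
  constructor
  · have := (valid_LOs (k := m) hl.valid (by simpa using hc)).1
    rw [LOs_coe] at this
    simpa using this
  · rw [List.pairwise_filter, List.pairwise_map]
    refine hl.2.imp_of_mem ?_
    intro u v hu hv huv h1 h2
    rw [← (hc u hu).head_lo (by simpa using h1), ← (hc v hv).head_lo (by simpa using h2)]
    exact huv

/-- if `LOs m (LR c) = LR a` then indices agree -/
theorem lo_fn {m : ℕ} {a c : W} (hc : ∀ w ∈ LR c, Cut m w) 
    (h : LOs m (LR c : Multiset W) = (LR a : Multiset W)) (i : ℕ) : 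
    (LR a).getD i [] = lo m ((LR c).getD i []) := by
  rw [← lo_getD (LR_good c)]
  rw [LOs_coe] at h
  rw [(good_lo (LR_good c) hc).perm_eq (LR_good a) (Multiset.coe_eq_coe.1 h)]

theorem cut_getD {m : ℕ} {l : List W} (hc : ∀ w ∈ l, Cut m w) (i : ℕ) : Cut m (l.getD i []) := by
  by_cases hi : i < l.length
  · rw [List.getD_eq_getElem _ _ hi]
    exact hc _ (List.getElem_mem hi)
  · rw [List.getD_eq_default _ _ (by omega)]
    exact List.Pairwise.nil

theorem lettersM_LOs (m : ℕ) (G : Multiset W) : 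
    lettersM (LOs m G) = (lettersM G).filter (fun x => x ≤ m) := by
  rw [LOs, lettersM_filter]
  induction G using Multiset.induction_on with
  | empty => simp [lettersM]
  | cons w G ih => 
    simp only [lettersM, Multiset.map_cons, Multiset.sum_cons, Multiset.filter_add] at ih ⊢
    rw [ih]
    congr 1

theorem shiftW_lo (m n : ℕ) (w : W) : lo (m + n) (shiftW m w) = shiftW m (lo n w) := by
  rw [lo, lo, shiftW, shiftW, List.filter_map]
  congr 1
  apply List.filter_congr
  intro x _
  rw [Bool.eq_iff_iff]
  simp; omega

theorem getD_mem_or {l : List W} (i : ℕ) : l.getD i [] ∈ l ∨ l.getD i [] = [] := by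
  by_cases hi : i < l.length
  · rw [List.getD_eq_getElem _ _ hi]
    exact Or.inl (List.getElem_mem hi)
  · rw [List.getD_eq_default _ _ (by omega)]
    exact Or.inr rfl

theorem split_cut {a b a' b' : W} (ha : IsPF a) (hb : IsPF b) (ha' : IsPF a') (hb' : IsPF b') 
    (h : splitProd a b = splitProd a' b') (hlt : a.length < a'.length) : 
    ∃ d, IsPF d ∧ d ≠ [] ∧ a' = splitProd a d := by
  obtain ⟨n, hn⟩ := Nat.exists_eq_add_of_lt hlt
  obtain ⟨k, hk⟩ : ∃ k, a'.length = a.length + k := ⟨n + 1, by omega⟩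
  have c1 := cond_splitProd ha hb
  have c2 := cond_splitProd ha' hb'
  rw [← h] at c2
  have hlen : a.length + b.length = a'.length + b'.length := by rw [← c1.length, ← c2.length]
  set c := splitProd a b with hcdef
  have hcut : ∀ w ∈ LR b, Cut k w := by
    intro w hw
    have : w ∈ (LR b : Multiset W) := by simpa using hw
    rw [← c1.2.2] at this
    obtain ⟨⟨v, hv, rfl⟩, _⟩ := mem_HIs.1 this
    have hv : v ∈ LR c := by simpa using hv
    refine ((cut_three a.length k v).1 ⟨?_, ?_⟩).2
    · rw [← hk]; exact c2.1 v hv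
    · exact (c1.1 v hv).filter _
  obtain ⟨d, hd⟩ := exists_of_valid (valid_LOs (k := k) (LR_good b).valid (by simpa using hcut))
  have hcond : Cond a d a' := by
    refine ⟨?_, ?_, ?_⟩
    · intro w hw
      have : w ∈ (LR a' : Multiset W) := by simpa using hw
      rw [← c2.2.1] at this
      obtain ⟨⟨v, hv, rfl⟩, _⟩ := mem_LOs.1 this
      exact (c1.1 v (by simpa using hv)).filter _
    · rw [← c2.2.1, hk, LOs_LOs, c1.2.1]
    · rw [← c2.2.1, hk, ← LOs_HIs, c1.2.2, hd]
  have hdl : d.length = k := by have := hcond.length; omega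
  have hletters : (d : Multiset ℕ) = ((b : Multiset ℕ)).filter (fun x => x ≤ k) := by
    rw [← lettersM_LR d, hd, lettersM_LOs, lettersM_LR]
  have hdp : d.Perm (b.filter (fun x => decide (x ≤ k))) := by
    rw [Multiset.filter_coe] at hletters
    exact Multiset.coe_eq_coe.1 hletters
  have hdPF : IsPF d := by
    rw [isPF_iff] at hb ⊢
    constructor
    · intro x hx
      exact hb.1 x (List.mem_filter.1 (hdp.mem_iff.1 hx)).1
    · intro j hj
      rw [hdp.countP_eq, List.countP_filter]
      refine (hb.2 j (by omega)).trans ?_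
      apply List.countP_mono_left
      intro x _ hx
      simp at hx ⊢
      omega
  refine ⟨d, hdPF, ?_, ?_⟩
  · intro e
    rw [e] at hdl
    simp at hdl
    omega
  · apply LR_ext
    intro i
    rw [fn_splitProd ha hdPF, lo_fn c2.1 c2.2.1, fn_splitProd ha hb, lo_append, hk, shiftW_lo, 
      ← lo_fn hcut hd.symm, lo_of_le]
    intro x hx
    rcases getD_mem_or (l := LR a) i with h1 | h1
    · have := X_le ha hb (by simpa using h1) x hx
      omega
    · rw [h1] at hx; simp at hx

theorem split_unique {a b a' b' : W} (ha : UnsplitablePF a) (hb : IsPF b) (ha' : UnsplitablePF a') 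
    (hb' : IsPF b') (h : splitProd a b = splitProd a' b') : a = a' ∧ b = b' := by
  have hl : a.length = a'.length := by
    rcases lt_trichotomy a.length a'.length with hlt | he | hlt
    · obtain ⟨d, h1, h2, h3⟩ := split_cut ha.1 hb ha'.1 hb' h hlt
      exact absurd ⟨a, d, ha.1, h1, ha.2.1, h2, h3⟩ ha'.2.2
    · exact he
    · obtain ⟨d, h1, h2, h3⟩ := split_cut ha'.1 hb' ha.1 hb h.symm hlt
      exact absurd ⟨a', d, ha'.1, h1, ha'.2.1, h2, h3⟩ ha.2.2
  have c1 := cond_splitProd ha.1 hb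
  have c2 := cond_splitProd ha'.1 hb'
  rw [← h] at c2
  exact ⟨c1.left_unique c2 hl, c1.right_unique c2 hl⟩

def phi (L : List W) : W := L.foldr splitProd []

theorem phi_cons (a : W) (L : List W) : phi (a :: L) = splitProd a (phi L) := rfl

theorem phi_isPF {L : List W} (h : ∀ x ∈ L, IsPF x) : IsPF (phi L) := by
  induction L with
  | nil => exact isPF_nil
  | cons a L ih => 
    rw [phi_cons]
    exact isPF_splitProd (h a (by simp)) (ih fun x hx => h x (by simp [hx]))

theorem splitProd_ne_nil {a b : W} (ha : IsPF a) (hb : IsPF b) (h : a ≠ []) : 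
    splitProd a b ≠ [] := by
  intro e
  have := length_splitProd ha hb
  rw [e] at this
  have h2 := List.length_pos_iff.2 h
  simp at this
  omega

theorem phi_inj {L L' : List W} (h : ∀ x ∈ L, UnsplitablePF x) (h' : ∀ x ∈ L', UnsplitablePF x) 
    (e : phi L = phi L') : L = L' := by
  induction L generalizing L' with
  | nil =>
    cases L' with
    | nil => rfl
    | cons a L' =>
      rw [phi_cons] at e
      exact absurd e.symm (splitProd_ne_nil (h' a (by simp)).1 
        (phi_isPF fun x hx => (h' x (by simp [hx])).1) (h' a (by simp)).2.1)
  | cons b L ih =>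
    cases L' with
    | nil => 
      rw [phi_cons] at e
      exact absurd e (splitProd_ne_nil (h b (by simp)).1 
        (phi_isPF fun x hx => (h x (by simp [hx])).1) (h b (by simp)).2.1)
    | cons a L' =>
      rw [phi_cons, phi_cons] at e
      obtain ⟨e1, e2⟩ := split_unique (h b (by simp)) (phi_isPF fun x hx => (h x (by simp [hx])).1)
        (h' a (by simp)) (phi_isPF fun x hx => (h' x (by simp [hx])).1) e
      rw [e1, ih (fun x hx => h x (by simp [hx])) (fun x hx => h' x (by simp [hx])) e2]

theorem phi_append {L L' : List W} (h : ∀ x ∈ L, IsPF x) (h' : ∀ x ∈ L', IsPF x) : 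
    phi (L ++ L') = splitProd (phi L) (phi L') := by
  induction L with
  | nil => rw [List.nil_append]; exact splitProd_nil_left.symm
  | cons a L ih =>
    have hL : ∀ x ∈ L, IsPF x := fun x hx => h x (by simp [hx])
    rw [List.cons_append, phi_cons, phi_cons, ih hL, 
      splitProd_assoc (h a (by simp)) (phi_isPF hL) (phi_isPF h')]

theorem phi_surj (n : ℕ) : ∀ p : W, IsPF p → p.length = n → 
    ∃ L : List W, (∀ x ∈ L, UnsplitablePF x) ∧ phi L = p := by
  induction n using Nat.strong_induction_on with
  | _ n ih =>
    intro p hp hn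
    by_cases h0 : p = []
    · exact ⟨[], by simp, h0.symm⟩
    by_cases hu : UnsplitablePF p
    · exact ⟨[p], by simpa using hu, splitProd_nil_right⟩
    · have : ∃ b c : W, IsPF b ∧ IsPF c ∧ b ≠ [] ∧ c ≠ [] ∧ p = splitProd b c := by
        by_contra h
        exact hu ⟨hp, h0, h⟩
      obtain ⟨b, c, hb, hc, hbn, hcn, rfl⟩ := this
      have hl := length_splitProd hb hc
      have h1 := List.length_pos_iff.2 hbn
      have h2 := List.length_pos_iff.2 hcn
      obtain ⟨L1, k1, e1⟩ := ih b.length (by omega) b hb rfl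
      obtain ⟨L2, k2, e2⟩ := ih c.length (by omega) c hc rfl
      refine ⟨L1 ++ L2, ?_, ?_⟩
      · intro x hx
        rcases List.mem_append.1 hx with hx | hx
        · exact k1 x hx
        · exact k2 x hx
      · rw [phi_append (fun x hx => (k1 x hx).1) (fun x hx => (k2 x hx).1), e1, e2]

/-! ordering -/

def dlt (u v : W) : Prop := u.map OrderDual.toDual < v.map OrderDual.toDual

noncomputable def keyW (c : W) : Lex (ℕ → List ℕᵒᵈ) := 
  toLex fun i => ((LR c).getD i []).map OrderDual.toDual

theorem keyW_lt {c d : W} (i : ℕ) (h : ∀ j < i, (LR c).getD j [] = (LR d).getD j []) 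
    (h2 : dlt ((LR c).getD i []) ((LR d).getD i [])) : keyW c < keyW d :=
  ⟨i, fun j hj => congrArg (List.map OrderDual.toDual) (h j hj), h2⟩

theorem exists_of_keyW_lt {c d : W} (h : keyW c < keyW d) : 
    ∃ i, (∀ j < i, (LR c).getD j [] = (LR d).getD j []) ∧ 
      dlt ((LR c).getD i []) ((LR d).getD i []) := by
  obtain ⟨i, h1, h2⟩ := h
  exact ⟨i, fun j hj => List.map_injective_iff.2 OrderDual.toDual.injective (h1 j hj), h2⟩

theorem dlt_append_shift (m : ℕ) {u v w : W} (h : dlt v w) : 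
    dlt (u ++ shiftW m v) (u ++ shiftW m w) := by
  have h2 : dlt (shiftW m v) (shiftW m w) := by
    unfold dlt at h ⊢
    have := List.map_lt (f := fun x : ℕᵒᵈ => OrderDual.toDual (OrderDual.ofDual x + m)) 
      (w := fun x y hxy => by
        have : OrderDual.ofDual y < OrderDual.ofDual x := hxy
        exact OrderDual.toDual_lt_toDual.2 (by omega)) h
    rw [List.map_map] at this
    simpa [shiftW, List.map_map, Function.comp_def] using this
  unfold dlt at h2 ⊢
  rw [List.map_append, List.map_append]
  exact List.append_left_lt h2

theorem perm_lex {Wl h : List W} (hW : GoodL Wl) 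
    (hp : (h.filter (fun w => decide (w ≠ []))).Perm Wl) : 
    (∀ i, h.getD i [] = Wl.getD i []) ∨ 
    ∃ i, (∀ j < i, h.getD j [] = Wl.getD j []) ∧ dlt (h.getD i []) (Wl.getD i []) := by
  induction Wl generalizing h with
  | nil => 
    left
    intro i
    have := hp.eq_nil
    rw [List.filter_eq_nil_iff] at this
    rcases getD_mem_or (l := h) i with h1 | h1
    · have := this _ h1
      simpa using this
    · rw [h1]; simp
  | cons w Wl ih =>
    have hw := hW.1 w (by simp)
    have hW2 := List.pairwise_cons.1 hW.2
    cases h with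
    | nil => simp at hp
    | cons x h =>
      by_cases hx : x = []
      · right
        refine ⟨0, by simp, ?_⟩
        subst hx
        cases w with
        | nil => exact absurd rfl hw.1
        | cons y ys => exact List.Lex.nil
      · have hp' : (x :: h.filter (fun w => decide (w ≠ []))).Perm (w :: Wl) := by
          simpa [hx] using hp
        by_cases hxw : x = w
        · subst hxw
          rcases ih ⟨fun u hu => hW.1 u (by simp [hu]), hW2.2⟩ (List.Perm.cons_inv hp') with h1 | h1
          · left
            intro i
            cases i with
            | zero => simp
            | succ i => simpa using h1 i
          · right
            obtain ⟨i, k1, k2⟩ := h1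
            refine ⟨i + 1, ?_, by simpa using k2⟩
            intro j hj
            cases j with
            | zero => simp
            | succ j => simpa using k1 j (by omega)
        · right
          refine ⟨0, by simp, ?_⟩
          have hmem : x ∈ w :: Wl := hp'.mem_iff.1 (by simp)
          have hmem : x ∈ Wl := by simpa [hxw] using hmem
          have := hW2.1 x hmem
          cases w with
          | nil => exact absurd rfl hw.1
          | cons y ys =>
            cases x with
            | nil => exact absurd rfl hx
            | cons z zs => exact List.Lex.rel (OrderDual.toDual_lt_toDual.2 (by simpa using this))

theorem Cond.key {a b c : W} (ha : IsPF a) (hb : IsPF b) (h : Cond a b c) : 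
    c = splitProd a b ∨ keyW c < keyW (splitProd a b) := by
  have hfn : ∀ i, (LR c).getD i [] = (LR a).getD i [] ++ 
      shiftW a.length (((LR c).map (hi a.length)).getD i []) := by
    intro i
    have e : ((LR c).map (hi a.length)).getD i [] = hi a.length ((LR c).getD i []) := by
      exact List.getD_map (LR c) [] (hi a.length)
    rw [e, lo_fn h.1 h.2.1 i, (cut_getD h.1 i).eq]
  have h3 := h.2.2
  rw [HIs_coe] at h3
  rcases perm_lex (LR_good b) (Multiset.coe_eq_coe.1 h3) with h1 | ⟨i, h1, h2⟩
  · left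
    apply LR_ext
    intro i
    rw [fn_splitProd ha hb, hfn, h1]
  · right
    apply keyW_lt i
    · intro j hj
      rw [fn_splitProd ha hb, hfn, h1 j hj]
    · rw [fn_splitProd ha hb, hfn]
      exact dlt_append_shift _ h2

theorem key_mono {a b b' : W} (ha : IsPF a) (hb : IsPF b) (hb' : IsPF b') (h : keyW b' < keyW b) : 
    keyW (splitProd a b') < keyW (splitProd a b) := by
  obtain ⟨i, h1, h2⟩ := exists_of_keyW_lt h
  apply keyW_lt i
  · intro j hj
    rw [fn_splitProd ha hb, fn_splitProd ha hb', h1 j hj]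
  · rw [fn_splitProd ha hb, fn_splitProd ha hb']
    exact dlt_append_shift _ h2

noncomputable def stB (K : Type) [Field K] : FW K →ₗ[K] FW K →ₗ[K] FW K :=
  Finsupp.linearCombination K (fun a => Finsupp.linearCombination K (fun b => mulSingle K a b))

theorem starF_eq (K : Type) [Field K] (x y : FW K) : starF K x y = stB K x y := by
  unfold starF stB
  rw [Finsupp.linearCombination_apply, Finsupp.sum, Finsupp.sum, LinearMap.sum_apply]
  refine Finset.sum_congr rfl fun a _ => ?_
  rw [LinearMap.smul_apply, Finsupp.linearCombination_apply, Finsupp.smul_sum]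
  simp only [smul_smul]

theorem stB_Mb (K : Type) [Field K] (a b : W) : 
    stB K (Mb K a) (Mb K b) = mulSingle K a b := by
  simp [stB, Mb]

/-- The span of the basis elements indexed by parking functions. -/
noncomputable def PFsp (K : Type) [Field K] : Submodule K (FW K) :=
  Submodule.span K {z : FW K | ∃ a : W, IsPF a ∧ z = Mb K a}

theorem Mb_mem (K : Type) [Field K] {a : W} (h : IsPF a) : Mb K a ∈ PFsp K := 
  Submodule.subset_span ⟨a, h, rfl⟩

theorem stB_PF (K : Type) [Field K] {a b : W} (ha : IsPF a) (hb : IsPF b) : 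
    stB K (Mb K a) (Mb K b) = ∑ c ∈ Sset a b, Mb K c := by
  rw [stB_Mb, mulSingle_eq K ha hb]

theorem stB_assoc_PF (K : Type) [Field K] {a b c : W} (ha : IsPF a) (hb : IsPF b) 
    (hc : IsPF c) : 
    stB K (stB K (Mb K a) (Mb K b)) (Mb K c) = 
      stB K (Mb K a) (stB K (Mb K b) (Mb K c)) := by
  rw [stB_PF K ha hb, stB_PF K hb hc, map_sum, map_sum, LinearMap.sum_apply]
  have e1 : ∀ e ∈ Sset a b, IsPF e := fun e he => Cond.isPF ((mem_Sset ha hb).1 he) ha hb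
  have e2 : ∀ e ∈ Sset b c, IsPF e := fun e he => Cond.isPF ((mem_Sset hb hc).1 he) hb hc
  rw [Finset.sum_congr rfl fun e he => stB_PF K (e1 e he) hc,
    Finset.sum_congr rfl fun e he => stB_PF K ha (e2 e he)]
  rw [← Finset.sum_biUnion, ← Finset.sum_biUnion]
  · congr 1
    ext d
    simp only [Finset.mem_biUnion]
    have h := Cond_assoc a b c d
    constructor
    · rintro ⟨e, he, hd⟩
      obtain ⟨f, hf, hd'⟩ := h.1 ⟨e, (mem_Sset ha hb).1 he, (mem_Sset (e1 e he) hc).1 hd⟩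
      have hf' := (mem_Sset hb hc).2 hf
      exact ⟨f, hf', (mem_Sset ha (e2 f hf')).2 hd'⟩
    · rintro ⟨e, he, hd⟩
      obtain ⟨f, hf, hd'⟩ := h.2 ⟨e, (mem_Sset hb hc).1 he, (mem_Sset ha (e2 e he)).1 hd⟩
      have hf' := (mem_Sset ha hb).2 hf
      exact ⟨f, hf', (mem_Sset (e1 f hf') hc).2 hd'⟩
  · intro e he f hf hne
    refine Finset.disjoint_left.2 fun d hd hd' => hne ?_
    exact Cond.right_unique ((mem_Sset ha (e2 e he)).1 hd) ((mem_Sset ha (e2 f hf)).1 hd') rfl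
  · intro e he f hf hne
    refine Finset.disjoint_left.2 fun d hd hd' => hne ?_
    refine Cond.left_unique ((mem_Sset (e1 e he) hc).1 hd) ((mem_Sset (e1 f hf) hc).1 hd') ?_
    rw [((mem_Sset ha hb).1 he).length, ((mem_Sset ha hb).1 hf).length]

theorem stB_assoc (K : Type) [Field K] {x y z : FW K} (hx : x ∈ PFsp K) (hy : y ∈ PFsp K) 
    (hz : z ∈ PFsp K) : 
    stB K (stB K x y) z = stB K x (stB K y z) := by
  induction hx using Submodule.span_induction with
  | zero => simp
  | add x x' _ _ h h' => simp [h, h']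
  | smul k x _ h => simp [h]
  | mem x hx =>
    obtain ⟨a, ha, rfl⟩ := hx
    induction hy using Submodule.span_induction with
    | zero => simp
    | add x x' _ _ h h' => simp [h, h']
    | smul k x _ h => simp [h]
    | mem x hx =>
      obtain ⟨b, hb, rfl⟩ := hx
      induction hz using Submodule.span_induction with
      | zero => simp
      | add x x' _ _ h h' => simp [h, h']
      | smul k x _ h => simp [h]
      | mem x hx =>
        obtain ⟨c, hc, rfl⟩ := hx
        exact stB_assoc_PF K ha hb hc

theorem stB_mem (K : Type) [Field K] {x y : FW K} (hx : x ∈ PFsp K) (hy : y ∈ PFsp K) : 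
    stB K x y ∈ PFsp K := by
  induction hx using Submodule.span_induction with
  | zero => simp
  | add x x' _ _ h h' => simpa using Submodule.add_mem _ h h'
  | smul k x _ h => simpa using Submodule.smul_mem _ k h
  | mem x hx =>
    obtain ⟨a, ha, rfl⟩ := hx
    induction hy using Submodule.span_induction with
    | zero => simp
    | add x x' _ _ h h' => simpa using Submodule.add_mem _ h h'
    | smul k x _ h => simpa using Submodule.smul_mem _ k h
    | mem x hx =>
      obtain ⟨b, hb, rfl⟩ := hx
      rw [stB_PF K ha hb]
      exact Submodule.sum_mem _ fun c hc => Mb_mem K (Cond.isPF ((mem_Sset ha hb).1 hc) ha hb)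

theorem cond_nil {b : W} (hb : IsPF b) : Cond [] b b := by
  have := cond_splitProd isPF_nil hb
  rwa [splitProd_nil_left] at this

theorem one_stB (K : Type) [Field K] {x : FW K} (hx : x ∈ PFsp K) : 
    stB K (Mb K []) x = x := by
  induction hx using Submodule.span_induction with
  | zero => simp
  | add x x' _ _ h h' => simp [h, h']
  | smul k x _ h => simp [h]
  | mem x hx =>
    obtain ⟨b, hb, rfl⟩ := hx
    rw [stB_PF K isPF_nil hb]
    have : Sset [] b = {b} := by
      ext c
      rw [mem_Sset isPF_nil hb, Finset.mem_singleton]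
      constructor
      · intro h
        exact (Cond.right_unique h (cond_nil (h.isPF isPF_nil hb)) rfl).symm
      · rintro rfl
        exact cond_nil hb
    rw [this, Finset.sum_singleton]

theorem starList_cons (K : Type) [Field K] (a : W) (L : List W) : 
    starList K (a :: L) = stB K (Mb K a) (starList K L) := by
  rw [← starF_eq]; rfl

theorem starList_mem (K : Type) [Field K] {L : List W} (h : ∀ x ∈ L, IsPF x) : 
    starList K L ∈ PFsp K := by
  induction L with
  | nil => exact Mb_mem K isPF_nil
  | cons a L ih =>
    rw [starList_cons]
    exact stB_mem K (Mb_mem K (h a (by simp))) (ih fun x hx => h x (by simp [hx]))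

theorem starList_append (K : Type) [Field K] {L₁ L₂ : List W} (h : ∀ x ∈ L₁, IsPF x) 
    (h2 : ∀ x ∈ L₂, IsPF x) : 
    starList K (L₁ ++ L₂) = stB K (starList K L₁) (starList K L₂) := by
  induction L₁ with
  | nil => exact (one_stB K (starList_mem K h2)).symm
  | cons a L ih =>
    have h' : ∀ x ∈ L, IsPF x := fun x hx => h x (by simp [hx])
    rw [List.cons_append, starList_cons, starList_cons, ih h',
      stB_assoc K (Mb_mem K (h a (by simp))) (starList_mem K h') (starList_mem K h2)]

/-- Span of the basis elements strictly below `p`. -/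
noncomputable def Low (K : Type) [Field K] (p : W) : Submodule K (FW K) :=
  Submodule.span K {z : FW K | ∃ c : W, (IsPF c ∧ c.length = p.length ∧ keyW c < keyW p) ∧ z = Mb K c}

theorem Low_apply (K : Type) [Field K] {p q : W} {y : FW K} (hy : y ∈ Low K p) 
    (h : ¬ keyW q < keyW p) : y q = 0 := by
  induction hy using Submodule.span_induction with
  | zero => simp
  | add x x' _ _ h h' => simp [h, h']
  | smul k x _ h => simp [h]
  | mem x hx =>
    obtain ⟨b, hb, rfl⟩ := hx
    rw [Mb, Finsupp.single_apply, if_neg]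
    rintro rfl
    exact h hb.2.2

theorem stB_lead (K : Type) [Field K] {a b : W} (ha : IsPF a) (hb : IsPF b) : 
    stB K (Mb K a) (Mb K b) - Mb K (splitProd a b) ∈ Low K (splitProd a b) := by
  have hm : splitProd a b ∈ Sset a b := (mem_Sset ha hb).2 (cond_splitProd ha hb)
  rw [stB_PF K ha hb, ← Finset.add_sum_erase _ _ hm, add_sub_cancel_left]
  refine Submodule.sum_mem _ fun c hc => Submodule.subset_span ⟨c, ?_, rfl⟩
  rw [Finset.mem_erase, mem_Sset ha hb] at hc
  refine ⟨hc.2.isPF ha hb, ?_, ?_⟩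
  · rw [hc.2.length, length_splitProd ha hb]
  · exact (hc.2.key ha hb).resolve_left hc.1

theorem stB_low (K : Type) [Field K] {a b : W} (ha : IsPF a) (hb : IsPF b) {y : FW K} 
    (hy : y ∈ Low K b) : stB K (Mb K a) y ∈ Low K (splitProd a b) := by
  induction hy using Submodule.span_induction with
  | zero => simp
  | add x x' _ _ h h' => simpa using Submodule.add_mem _ h h'
  | smul k x _ h => simpa using Submodule.smul_mem _ k h
  | mem x hx =>
    obtain ⟨c, ⟨hc, hl, hk⟩, rfl⟩ := hx
    have hlt := key_mono ha hb hc hk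
    rw [stB_PF K ha hc]
    refine Submodule.sum_mem _ fun d hd => Submodule.subset_span ⟨d, ?_, rfl⟩
    rw [mem_Sset ha hc] at hd
    refine ⟨hd.isPF ha hc, ?_, ?_⟩
    · rw [hd.length, length_splitProd ha hb, hl]
    · rcases hd.key ha hc with rfl | h
      · exact hlt
      · exact h.trans hlt

theorem starList_lead (K : Type) [Field K] {L : List W} (h : ∀ x ∈ L, IsPF x) : 
    starList K L - Mb K (phi L) ∈ Low K (phi L) := by
  induction L with
  | nil => 
    have : starList K [] - Mb K (phi []) = 0 := sub_self _
    rw [this]; exact Submodule.zero_mem _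
  | cons a L ih =>
    have h' : ∀ x ∈ L, IsPF x := fun x hx => h x (by simp [hx])
    have ha := h a (by simp)
    have hp := phi_isPF h'
    have e : starList K (a :: L) - Mb K (phi (a :: L)) = 
        stB K (Mb K a) (starList K L - Mb K (phi L)) + 
        (stB K (Mb K a) (Mb K (phi L)) - Mb K (splitProd a (phi L))) := by
      rw [starList_cons, phi_cons, map_sub]; abel
    rw [e, phi_cons]
    exact Submodule.add_mem _ (stB_low K ha hp (ih h')) (stB_lead K ha hp)

theorem pf_finite (n : ℕ) : {a : W | IsPF a ∧ a.length = n}.Finite := by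
  refine ((List.finite_length_eq (Fin (n + 1)) n).image (List.map Fin.val)).subset ?_
  rintro a ⟨ha, hl⟩
  refine ⟨a.pmap (fun x hx => (⟨x, hx⟩ : Fin (n + 1))) ?_, ?_, ?_⟩
  · intro x hx
    have := ha.le_length x hx
    omega
  · simpa using hl
  · rw [List.map_pmap]; simp

theorem Mb_mem_range (K : Type) [Field K] (a : W) (ha : IsPF a) : 
    Mb K a ∈ Submodule.span K (Set.range (fun L : List {a : W // UnsplitablePF a} =>
          starList K (L.map Subtype.val))) := by
  set R := Submodule.span K (Set.range (fun L : List {a : W // UnsplitablePF a} =>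
          starList K (L.map Subtype.val))) with hR
  have key : ∀ N : ℕ, ∀ a, IsPF a → 
      {c | (IsPF c ∧ c.length = a.length) ∧ keyW c < keyW a}.ncard = N → Mb K a ∈ R := by
    intro N
    induction N using Nat.strong_induction_on with
    | _ N ih =>
      intro a ha hN
      obtain ⟨L, hL, rfl⟩ := phi_surj _ a ha rfl
      have h1 := starList_lead K (L := L) fun x hx => (hL x hx).1
      have h2 : starList K L ∈ R := by
        refine Submodule.subset_span ⟨L.pmap (fun x hx => ⟨x, hx⟩) hL, ?_⟩
        simp only [List.map_pmap]
        simp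
      have h3 : Low K (phi L) ≤ R := by
        refine Submodule.span_le.2 ?_
        rintro _ ⟨c, ⟨hc, hl, hk⟩, rfl⟩
        refine ih _ ?_ c hc rfl
        rw [← hN]
        apply Set.ncard_lt_ncard
        · refine ⟨?_, ?_⟩
          · rintro d ⟨⟨hd, hdl⟩, hdk⟩
            exact ⟨⟨hd, hdl.trans hl⟩, hdk.trans hk⟩
          · intro hs
            have := hs (show c ∈ _ from ⟨⟨hc, hl⟩, hk⟩)
            exact lt_irrefl _ this.2
        · exact (pf_finite _).subset fun d hd => hd.1
      have := Submodule.sub_mem _ h2 (h3 h1)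
      simpa using this
  exact key _ a ha rfl

theorem starList_li (K : Type) [Field K] : LinearIndependent K
      (fun L : List {a : W // UnsplitablePF a} => starList K (L.map Subtype.val)) := by
  rw [linearIndependent_iff]
  intro l hl
  by_contra hne
  obtain ⟨L, hL, hmax⟩ := Finset.exists_max_image l.support 
    (fun L => keyW (phi (L.map Subtype.val))) (Finsupp.support_nonempty_iff.2 hne)
  have hU : ∀ L : List {a : W // UnsplitablePF a}, ∀ x ∈ L.map Subtype.val, UnsplitablePF x := by
    intro L x hx
    obtain ⟨y, _, rfl⟩ := List.mem_map.1 hx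
    exact y.2
  have h := congrArg (fun z : FW K => z (phi (L.map Subtype.val))) hl
  simp only [Finsupp.linearCombination_apply, Finsupp.sum, Finsupp.finsetSum_apply, 
    Finsupp.smul_apply, Finsupp.zero_apply] at h
  have hval : ∀ L' ∈ l.support, starList K (L'.map Subtype.val) (phi (L.map Subtype.val)) = 
      if L' = L then 1 else 0 := by
    intro L' hL'
    have h1 := Low_apply K (starList_lead K (L := L'.map Subtype.val) fun x hx => (hU L' x hx).1)
      (not_lt.2 (hmax L' hL'))
    rw [Finsupp.sub_apply, sub_eq_zero, Mb, Finsupp.single_apply] at h1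
    rw [h1]
    congr 1
    apply propext
    constructor
    · intro e
      exact (List.map_injective_iff.2 Subtype.val_injective) (phi_inj (hU _) (hU _) e)
    · rintro rfl; rfl
  rw [Finset.sum_congr rfl fun L' hL' => by rw [hval L' hL']] at h
  simp at h
  exact (Finsupp.mem_support_iff.1 hL) h

/-- The algebra `(KP, ⋆)` is freely generated by
`{M_a : a unsplitable}`: the canonical map from the free associative algebra on
the unsplitable parking functions is multiplicative, and it carries the basis of
the free algebra (words in the generators) to a linearly independent family
whose span is exactly `KP`; i.e. it is an algebra isomorphism onto `(KP, ⋆)`. -/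
theorem stmt10 (K : Type) [Field K] [CharZero K] :
    (∀ L₁ L₂ : List W, (∀ x ∈ L₁ ++ L₂, UnsplitablePF x) →
      starList K (L₁ ++ L₂) = starF K (starList K L₁) (starList K L₂)) ∧
    LinearIndependent K
      (fun L : List {a : W // UnsplitablePF a} => starList K (L.map Subtype.val)) ∧
    Submodule.span K
        (Set.range (fun L : List {a : W // UnsplitablePF a} =>
          starList K (L.map Subtype.val))) =
      Submodule.span K {z : FW K | ∃ a : W, IsPF a ∧ z = Mb K a} := by
  refine ⟨?_, starList_li K, ?_⟩
  · intro L₁ L₂ h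
    rw [starF_eq]
    exact starList_append K (fun x hx => (h x (by simp [hx])).1) (fun x hx => (h x (by simp [hx])).1)
  · apply le_antisymm
    · refine Submodule.span_le.2 ?_
      rintro _ ⟨L, rfl⟩
      refine starList_mem K fun x hx => ?_
      obtain ⟨y, _, rfl⟩ := List.mem_map.1 hx
      exact y.2.1
    · refine Submodule.span_le.2 ?_
      rintro _ ⟨a, ha, rfl⟩
      exact Mb_mem_range K a ha
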